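/- Let k be an even integer ≥ 4. (a) The point 1/2 + i·(√3/2) is a zero of E_k' if and only if k ≡ 2 (mod 6). (b) The number of zeros of E_k' on the open half-line {1/2 + it : t > √3/2} is ⌊(k−4)/6⌋. -/

import Mathlib

/-- The normalized Eisenstein series of even weight `k ≥ 4` (the definition also
makes sense for `k = 2`, giving the quasi-modular Eisenstein series `E₂`), defined by
its Fourier expansion `E_k(z) = 1 - (2k/B_k) ∑_{n≥1} σ_{k-1}(n) qⁿ`, `q = exp(2πiz)`. -/
noncomputable def Ek (k : ℕ) (z : ℂ) : ℂ :=
  1 - (2 * (k : ℂ) / ((bernoulli k : ℚ) : ℂ)) *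
    ∑' n : ℕ, (∑ d ∈ n.divisors, (d : ℂ) ^ (k - 1)) * Complex.exp (2 * Real.pi * Complex.I * z) ^ n

open Complex Metric Set
open scoped MatrixGroups

/-- The Fourier coefficients `n σ_{k-1}(n)` of the derivative of the Eisenstein series. -/
noncomputable def derivCoeff (k n : ℕ) : ℝ := n * ∑ d ∈ n.divisors, (d : ℝ) ^ (k - 1)

/-- The derivative of the Eisenstein series, up to a constant, as a function of `q`. -/
noncomputable def derivSeries (k : ℕ) (q : ℂ) : ℂ := ∑' n : ℕ, (derivCoeff k n : ℂ) * q ^ n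

lemma derivCoeff_nonneg (k n : ℕ) : 0 ≤ derivCoeff k n := by
  unfold derivCoeff; positivity

lemma pow_le_derivCoeff {k n : ℕ} (hk : 1 ≤ k) : (n : ℝ) ^ k ≤ derivCoeff k n := by
  rcases Nat.eq_zero_or_pos n with rfl | hn
  · simp [derivCoeff, show k ≠ 0 by omega]
  obtain ⟨j, rfl⟩ := Nat.exists_eq_add_of_le' hk
  rw [derivCoeff, Nat.add_sub_cancel, pow_succ']
  gcongr
  exact Finset.single_le_sum (f := fun d : ℕ => (d : ℝ) ^ j) (fun d _ => by positivity)
    (Nat.mem_divisors_self n hn.ne')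

lemma derivCoeff_le {k n : ℕ} (hk : 3 ≤ k) : derivCoeff k n ≤ 2 * (n : ℝ) ^ k := by
  rcases Nat.eq_zero_or_pos n with rfl | hn
  · simp [derivCoeff, show k ≠ 0 by omega]
  obtain ⟨j, rfl⟩ := Nat.exists_eq_add_of_le' hk
  have hn' : (0 : ℝ) < n := by exact_mod_cast hn
  rw [derivCoeff, show j + 3 - 1 = j + 2 by omega, ← Nat.sum_div_divisors]
  have h1 : ∀ e ∈ n.divisors, ((n / e : ℕ) : ℝ) ^ (j + 2) ≤ (n : ℝ) ^ (j + 2) * ((e : ℝ) ^ 2)⁻¹ := by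
    intro e he
    have he1 : 1 ≤ e := Nat.pos_of_mem_divisors he
    have he' : (1 : ℝ) ≤ e := by exact_mod_cast he1
    rw [Nat.cast_div (Nat.dvd_of_mem_divisors he) (by positivity), div_pow, div_eq_mul_inv]
    gcongr
    omega
  have h2 : ∑ e ∈ n.divisors, ((e : ℝ) ^ 2)⁻¹ ≤ 2 := by
    calc ∑ e ∈ n.divisors, ((e : ℝ) ^ 2)⁻¹ ≤ ∑ e ∈ Finset.Ioo 0 (n + 1), ((e : ℝ) ^ 2)⁻¹ := by
          refine Finset.sum_le_sum_of_subset_of_nonneg ?_ fun i _ _ => by positivity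
          intro e he
          have := Nat.divisor_le he
          have := Nat.pos_of_mem_divisors he
          simp; omega
      _ ≤ 2 := by simpa using sum_Ioo_inv_sq_le (α := ℝ) 0 (n + 1)
  calc (n : ℝ) * ∑ e ∈ n.divisors, ((n / e : ℕ) : ℝ) ^ (j + 2)
      ≤ n * ∑ e ∈ n.divisors, (n : ℝ) ^ (j + 2) * ((e : ℝ) ^ 2)⁻¹ := by
        gcongr with e he; exact h1 e he
    _ = n ^ (j + 3) * ∑ e ∈ n.divisors, ((e : ℝ) ^ 2)⁻¹ := by rw [← Finset.mul_sum]; ring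
    _ ≤ n ^ (j + 3) * 2 := by gcongr
    _ = 2 * (n : ℝ) ^ (j + 3) := by ring

lemma summable_derivCoeff_mul_pow {k : ℕ} (hk : 3 ≤ k) {x : ℝ} (h0 : 0 ≤ x) (h1 : x < 1) :
    Summable fun n : ℕ => derivCoeff k n * x ^ n := by
  have := (summable_norm_pow_mul_geometric_of_norm_lt_one k
    (r := x) (by rwa [Real.norm_of_nonneg h0])).mul_left 2
  refine Summable.of_nonneg_of_le (fun n => mul_nonneg (derivCoeff_nonneg k n) (by positivity))
    (fun n => ?_) this
  rw [Real.norm_of_nonneg (by positivity), ← mul_assoc]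
  gcongr
  exact derivCoeff_le hk

lemma differentiableOn_derivSeries {k : ℕ} (hk : 3 ≤ k) :
    DifferentiableOn ℂ (derivSeries k) (ball 0 1) := by
  intro q hq
  rw [mem_ball_zero_iff] at hq
  obtain ⟨r, hqr, hr⟩ := exists_between hq
  have hr0 : 0 ≤ r := (norm_nonneg q).trans hqr.le
  have := differentiableOn_tsum_of_summable_norm (U := ball (0 : ℂ) r)
    (F := fun n q => (derivCoeff k n : ℂ) * q ^ n) (summable_derivCoeff_mul_pow hk hr0 hr)
    (fun n => by fun_prop) isOpen_ball (fun n w hw => by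
      rw [mem_ball_zero_iff] at hw
      rw [norm_mul, norm_real, norm_pow, Real.norm_of_nonneg (derivCoeff_nonneg k n)]
      exact mul_le_mul_of_nonneg_left (pow_le_pow_left₀ (norm_nonneg _) hw.le _)
        (derivCoeff_nonneg k n))
  exact (this.differentiableAt (isOpen_ball.mem_nhds
    (by simpa using hqr))).differentiableWithinAt

lemma derivSeries_ofReal (k : ℕ) (x : ℝ) :
    derivSeries k x = ((∑' n : ℕ, derivCoeff k n * x ^ n : ℝ) : ℂ) := by
  rw [derivSeries, ofReal_tsum]
  push_cast
  rfl

lemma derivSeries_zero (k : ℕ) : derivSeries k 0 = 0 := by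
  rw [derivSeries]
  refine (tsum_congr fun n => ?_).trans tsum_zero
  rcases n with _ | n <;> simp [derivCoeff]

lemma norm_exp_two_pi_I_mul (z : ℂ) : ‖exp (2 * Real.pi * I * z)‖ = Real.exp (-(2 * Real.pi * z.im)) := by
  rw [norm_exp]; simp

lemma hasDerivAt_Ek {k : ℕ} (hk : 3 ≤ k) {z : ℂ} (hz : 0 < z.im) :
    HasDerivAt (Ek k) (-(2 * (k : ℂ) / ((bernoulli k : ℚ) : ℂ)) * (2 * Real.pi * I) *
      derivSeries k (exp (2 * Real.pi * I * z))) z := by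
  obtain ⟨y, hy0, hy⟩ := exists_between hz
  set U : Set ℂ := {w | y < w.im} with hU
  have hUo : IsOpen U := isOpen_lt continuous_const continuous_im
  set r := Real.exp (-(2 * Real.pi * y)) with hr
  have hr1 : r < 1 := by rw [hr, Real.exp_lt_one_iff]; have := Real.pi_pos; nlinarith
  have hsum := summable_derivCoeff_mul_pow hk (Real.exp_pos _).le hr1
  set F : ℕ → ℂ → ℂ := fun n w =>
    (∑ d ∈ n.divisors, (d : ℂ) ^ (k - 1)) * exp (2 * Real.pi * I * w) ^ n with hF
  have hF' : ∀ n w, HasDerivAt (F n)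
      ((2 * Real.pi * I) * ((derivCoeff k n : ℂ) * exp (2 * Real.pi * I * w) ^ n)) w := by
    intro n w
    have h1 : HasDerivAt (fun w : ℂ => exp (2 * Real.pi * I * w))
        (exp (2 * Real.pi * I * w) * (2 * Real.pi * I)) w := by
      simpa using ((hasDerivAt_id w).const_mul (2 * Real.pi * I)).cexp
    have h2 := (h1.pow n).const_mul (∑ d ∈ n.divisors, (d : ℂ) ^ (k - 1))
    refine HasDerivAt.congr_deriv (f := F n) h2 ?_
    rcases n with _ | n
    · simp [derivCoeff]
    · simp only [derivCoeff]; push_cast; rw [pow_succ]; ring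
  have hd : ∀ n, DifferentiableOn ℂ (F n) U := fun n w _ =>
    (hF' n w).differentiableAt.differentiableWithinAt
  have hle : ∀ (n : ℕ) (w : ℂ), w ∈ U → ‖F n w‖ ≤ derivCoeff k n * r ^ n := by
    intro n w hw
    rcases n with _ | n
    · simp [hF, derivCoeff]
    rw [hF]
    simp only
    rw [norm_mul, norm_pow, norm_exp_two_pi_I_mul]
    have h1 : ‖∑ d ∈ (n + 1).divisors, (d : ℂ) ^ (k - 1)‖ ≤ derivCoeff k (n + 1) := by
      refine (norm_sum_le _ _).trans ?_
      simp only [norm_pow, Complex.norm_natCast, derivCoeff]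
      have hn1 : (1 : ℝ) ≤ ((n + 1 : ℕ) : ℝ) := by exact_mod_cast Nat.le_add_left 1 n
      exact le_mul_of_one_le_left (by positivity) hn1
    have h2 : Real.exp (-(2 * Real.pi * w.im)) ≤ r := by
      rw [hr, Real.exp_le_exp]
      have : y < w.im := hw
      have := Real.pi_pos
      nlinarith
    exact mul_le_mul h1 (pow_le_pow_left₀ (Real.exp_pos _).le h2 _) (by positivity)
      (derivCoeff_nonneg _ _)
  have hder := hasSum_deriv_of_summable_norm hsum hd hUo hle (show z ∈ U from hy)
  have hdiff := (differentiableOn_tsum_of_summable_norm hsum hd hUo hle).differentiableAt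
    (hUo.mem_nhds (show z ∈ U from hy))
  have hval : deriv (fun w => ∑' n, F n w) z
      = (2 * Real.pi * I) * derivSeries k (exp (2 * Real.pi * I * z)) := by
    rw [← hder.tsum_eq, derivSeries, ← tsum_mul_left]
    exact tsum_congr fun n => (hF' n z).deriv
  have := ((hval ▸ hdiff.hasDerivAt).const_mul
    (2 * (k : ℂ) / ((bernoulli k : ℚ) : ℂ))).const_sub 1
  refine HasDerivAt.congr_deriv (f := Ek k) this ?_
  ring

lemma bernoulli_ne_zero_of_even {k : ℕ} (hk : 2 ≤ k) (hke : Even k) : bernoulli k ≠ 0 := by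
  obtain ⟨m, rfl⟩ := hke
  have hm : m ≠ 0 := by omega
  intro h
  have h1 := riemannZeta_two_mul_nat hm
  rw [← two_mul] at h
  rw [h] at h1
  refine riemannZeta_ne_zero_of_one_le_re (s := 2 * (m : ℂ)) ?_ (by rw [h1]; simp)
  have : (1 : ℝ) ≤ m := by exact_mod_cast Nat.one_le_iff_ne_zero.2 hm
  simp; linarith

lemma deriv_Ek_eq_zero_iff {k : ℕ} (hk : 3 ≤ k) (hke : Even k) {z : ℂ} (hz : 0 < z.im) :
    deriv (Ek k) z = 0 ↔ derivSeries k (exp (2 * Real.pi * I * z)) = 0 := by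
  rw [(hasDerivAt_Ek hk hz).deriv, mul_eq_zero, or_iff_right]
  have h1 : ((bernoulli k : ℚ) : ℂ) ≠ 0 := by
    exact_mod_cast bernoulli_ne_zero_of_even (by omega) hke
  have h2 : (k : ℂ) ≠ 0 := by exact_mod_cast (by omega : k ≠ 0)
  have h3 : (Real.pi : ℂ) ≠ 0 := by exact_mod_cast Real.pi_ne_zero
  simp [h1, h2, h3]

lemma derivSeries_eq_tsum {k : ℕ} (hk : 3 ≤ k) {q : ℂ} (hq : ‖q‖ < 1) :
    (Summable fun c : ℕ+ × ℕ+ => (c.1 : ℂ) * ((c.2 : ℂ) ^ k * q ^ (c.1 * c.2 : ℕ))) ∧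
    derivSeries k q = ∑' c : ℕ+, (c : ℂ) * ∑' m : ℕ+, (m : ℂ) ^ k * (q ^ (c : ℕ)) ^ (m : ℕ) := by
  have hfib : ∀ (q : ℂ) (n : ℕ+),
      ∑' x : Nat.divisorsAntidiagonal n, (x.1.1 : ℂ) * ((x.1.2 : ℂ) ^ k * q ^ (x.1.1 * x.1.2 : ℕ))
        = (derivCoeff k n : ℂ) * q ^ (n : ℕ) := by
    intro q n
    rw [tsum_fintype, Finset.univ_eq_attach, (n : ℕ).divisorsAntidiagonal.sum_attach
      (fun x => (x.1 : ℂ) * ((x.2 : ℂ) ^ k * q ^ (x.1 * x.2 : ℕ))),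
      Nat.sum_divisorsAntidiagonal' (fun x y => (x : ℂ) * ((y : ℂ) ^ k * q ^ (x * y)))]
    simp only [derivCoeff]
    push_cast
    rw [Finset.mul_sum, Finset.sum_mul]
    refine Finset.sum_congr rfl fun d hd => ?_
    rw [Nat.div_mul_cancel (Nat.dvd_of_mem_divisors hd)]
    have : ((n : ℕ) : ℂ) = ((n / d : ℕ) : ℂ) * d := by
      rw [← Nat.cast_mul, Nat.div_mul_cancel (Nat.dvd_of_mem_divisors hd)]
    obtain ⟨j, rfl⟩ := Nat.exists_eq_add_of_le' hk
    rw [this, show j + 3 - 1 = j + 2 by omega]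
    ring
  have hsig : Summable fun c : (Σ n : ℕ+, Nat.divisorsAntidiagonal n) =>
      (c.2.1.1 : ℂ) * ((c.2.1.2 : ℂ) ^ k * q ^ (c.2.1.1 * c.2.1.2 : ℕ)) := by
    apply Summable.of_norm
    rw [summable_sigma_of_nonneg (fun a => by positivity)]
    refine ⟨fun n => (hasSum_fintype _).summable, ?_⟩
    refine ((summable_derivCoeff_mul_pow hk (norm_nonneg q) hq).comp_injective
      PNat.coe_injective).congr fun n => ?_
    have := hfib (‖q‖ : ℂ) n
    rw [← ofReal_inj]
    simp only [Function.comp_apply]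
    push_cast
    rw [← this]
    refine tsum_congr fun x => ?_
    simp
  have hsum : Summable fun c : ℕ+ × ℕ+ => (c.1 : ℂ) * ((c.2 : ℂ) ^ k * q ^ (c.1 * c.2 : ℕ)) := by
    rw [← sigmaAntidiagonalEquivProd.summable_iff]
    exact hsig
  refine ⟨hsum, ?_⟩
  have h1 : derivSeries k q = ∑' n : ℕ+, (derivCoeff k n : ℂ) * q ^ (n : ℕ) := by
    rw [derivSeries, ← tsum_zero_pnat_eq_tsum_nat]
    · simp [derivCoeff]
    · refine Summable.of_norm ((summable_derivCoeff_mul_pow hk (norm_nonneg q) hq).congr fun n => ?_)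
      rw [norm_mul, norm_real, norm_pow, Real.norm_of_nonneg (derivCoeff_nonneg k n)]
  have h2 : ∑' c : ℕ+ × ℕ+, (c.1 : ℂ) * ((c.2 : ℂ) ^ k * q ^ (c.1 * c.2 : ℕ))
      = ∑' n : ℕ+, (derivCoeff k n : ℂ) * q ^ (n : ℕ) := by
    rw [← sigmaAntidiagonalEquivProd.tsum_eq]
    refine (hsig.tsum_sigma).trans (tsum_congr fun n => hfib q n)
  rw [h1, ← h2, hsum.tsum_prod]
  refine tsum_congr fun c => ?_
  rw [← tsum_mul_left]
  exact tsum_congr fun m => by rw [pow_mul]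

/-- The lattice sum expansion of the derivative of the Eisenstein series. -/
lemma derivSeries_eq_lattice {k : ℕ} (hk : 3 ≤ k) {z : ℂ} (hz : 0 < z.im) :
    HasSum (fun c : ℕ+ => (c : ℂ) * ∑' d : ℤ, 1 / (c * z + d) ^ (k + 1))
      ((-2 * Real.pi * I) ^ (k + 1) / k.factorial * derivSeries k (exp (2 * Real.pi * I * z))) := by
  have hq : ‖exp (2 * Real.pi * I * z)‖ < 1 := by
    rw [norm_exp_two_pi_I_mul, Real.exp_lt_one_iff]
    have := mul_pos Real.pi_pos hz
    linarith
  obtain ⟨hs, he⟩ := derivSeries_eq_tsum hk hq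
  have hs' : Summable fun c : ℕ+ => (c : ℂ) * ∑' m : ℕ+,
      (m : ℂ) ^ k * (exp (2 * Real.pi * I * z) ^ (c : ℕ)) ^ (m : ℕ) := by
    refine hs.prod.congr fun c => ?_
    rw [← tsum_mul_left]
    exact tsum_congr fun m => by rw [pow_mul]
  rw [he]
  suffices hfun : (fun c : ℕ+ => (c : ℂ) * ∑' d : ℤ, 1 / (c * z + d) ^ (k + 1)) = fun c : ℕ+ =>
      ((-2 * Real.pi * I) ^ (k + 1) / k.factorial : ℂ) * ((c : ℂ) * ∑' m : ℕ+,
        (m : ℂ) ^ k * (exp (2 * Real.pi * I * z) ^ (c : ℕ)) ^ (m : ℕ)) by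
    rw [hfun]
    exact hs'.hasSum.mul_left _
  funext c
  have hcz : 0 < ((c : ℂ) * z).im := by
    have : (0 : ℝ) < c := by exact_mod_cast c.pos
    simpa using mul_pos this hz
  have := EisensteinSeries.qExpansion_identity_pnat (k := k) (by omega) ⟨(c : ℂ) * z, hcz⟩
  simp only at this
  rw [this, ← exp_nat_mul]
  rw [show (2 * Real.pi * I * ((c : ℂ) * z)) = (c : ℕ) * (2 * Real.pi * I * z) by ring]
  ring

/-- A continuous map whose exponential is constantly one on `[a, b]` takes the same value at the
endpoints. -/
lemma eq_of_exp_eq_one {a b : ℝ} (hab : a ≤ b) {f : ℝ → ℂ} (hf : ContinuousOn f (Icc a b))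
    (h1 : ∀ x ∈ Icc a b, exp (f x) = 1) : f a = f b := by
  have hint : ∀ x ∈ Icc a b, ∃ n : ℤ, f x = n * (2 * Real.pi * I) := fun x hx =>
    exp_eq_one_iff.mp (h1 x hx)
  have hc : ContinuousOn (fun x => (f x).im / (2 * Real.pi)) (Icc a b) :=
    (continuous_im.comp_continuousOn hf).div_const _
  have : DiscreteTopology (range ((↑) : ℤ → ℝ)) :=
    Int.isClosedEmbedding_coe_real.isEmbedding.toHomeomorph.symm.isEmbedding.discreteTopology
  have hm : MapsTo (fun x => (f x).im / (2 * Real.pi)) (Icc a b) (range ((↑) : ℤ → ℝ)) := by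
    intro x hx
    obtain ⟨n, hn⟩ := hint x hx
    refine ⟨n, ?_⟩
    simp only [hn]
    have : ((n : ℂ) * (2 * Real.pi * I)).im = n * (2 * Real.pi) := by simp
    rw [this]
    field_simp
  have key := isPreconnected_Icc.constant_of_mapsTo ⟨this⟩ hc hm (left_mem_Icc.2 hab) (right_mem_Icc.2 hab)
  obtain ⟨n, hn⟩ := hint a (left_mem_Icc.2 hab)
  obtain ⟨m, hm⟩ := hint b (right_mem_Icc.2 hab)
  have e1 : ∀ n : ℤ, ((n : ℂ) * (2 * Real.pi * I)).im / (2 * Real.pi) = n := by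
    intro n
    have : ((n : ℂ) * (2 * Real.pi * I)).im = n * (2 * Real.pi) := by simp
    rw [this]; field_simp
  simp only [hn, hm, e1] at key
  rw [hn, hm]
  norm_cast at key
  rw [key]

lemma isSimplyConnected_univ_complex : IsSimplyConnected (univ : Set ℂ) :=
  have : ContractibleSpace (univ : Set ℂ) := (Homeomorph.Set.univ ℂ).contractibleSpace
  (inferInstance : SimplyConnectedSpace (univ : Set ℂ))

/-- A zero-free continuous function on a closed disc has a continuous logarithm there. -/
lemma exists_log_closedBall {r : ℝ} (hr : 0 < r) {g : ℂ → ℂ}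
    (hg : ContinuousOn g (closedBall 0 r)) (h0 : ∀ z ∈ closedBall (0 : ℂ) r, g z ≠ 0) :
    ∃ G : ℂ → ℂ, Continuous G ∧ ∀ z ∈ closedBall (0 : ℂ) r, exp (G z) = g z := by
  let φ : ℂ → ℂ := fun z => ((r / max r ‖z‖ : ℝ) : ℂ) * z
  have hmax : ∀ z : ℂ, 0 < max r ‖z‖ := fun z => lt_max_of_lt_left hr
  have hφc : Continuous φ := by
    refine Continuous.mul (continuous_ofReal.comp ?_) continuous_id
    exact continuous_const.div (by fun_prop) fun z => (hmax z).ne'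
  have hφm : ∀ z, φ z ∈ closedBall (0 : ℂ) r := by
    intro z
    rw [mem_closedBall_zero_iff, norm_mul, norm_real, Real.norm_of_nonneg
      (div_nonneg hr.le (hmax z).le), div_mul_eq_mul_div, div_le_iff₀ (hmax z)]
    exact mul_le_mul_of_nonneg_left (le_max_right _ _) hr.le
  have hφid : ∀ z ∈ closedBall (0 : ℂ) r, φ z = z := by
    intro z hz
    rw [mem_closedBall_zero_iff] at hz
    simp [φ, max_eq_left hz, hr.ne']
  have hgφ : Continuous (g ∘ φ) := hg.comp_continuous hφc hφm
  obtain ⟨G, hG, hGe⟩ := Complex.exists_continuousOn_eqOn_exp_comp (U := (univ : Set ℂ))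
    (g := g ∘ φ) isSimplyConnected_univ_complex isOpen_univ hgφ.continuousOn
    (by rintro ⟨z, -, hz⟩; exact h0 _ (hφm z) hz)
  refine ⟨G, continuousOn_univ.mp hG, fun z hz => ?_⟩
  have := hGe (mem_univ z)
  simpa [hφid z hz] using this

lemma exists_zero_factorization {r : ℝ} (hr : 0 < r) {F : ℂ → ℂ}
    (hF : AnalyticOnNhd ℂ F (closedBall 0 r)) (hs : ∀ z ∈ sphere (0 : ℂ) r, F z ≠ 0)
    (S : Finset ℂ) (hS : ∀ a ∈ S, ‖a‖ < r ∧ F a = 0) :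
    ∃ (T : Finset ℂ) (m : ℂ → ℕ) (g : ℂ → ℂ), S ⊆ T ∧ (∀ a ∈ T, ‖a‖ < r ∧ 1 ≤ m a) ∧
      ContinuousOn g (closedBall 0 r) ∧ (∀ z ∈ closedBall (0 : ℂ) r, g z ≠ 0) ∧
      ∀ z ∈ closedBall (0 : ℂ) r, F z = (∏ a ∈ T, (z - a) ^ m a) * g z := by
  set U := closedBall (0 : ℂ) r with hU
  have hpre : IsPreconnected U := (convex_closedBall 0 r).isPreconnected
  have hrU : (r : ℂ) ∈ U := by simp [hU, abs_of_pos hr]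
  have h0U : (0 : ℂ) ∈ U := by simp [hU, hr.le]
  have hrF : F r ≠ 0 := hs _ (by simp [abs_of_pos hr])
  have hnt : U.Nontrivial := ⟨r, hrU, 0, h0U, by exact_mod_cast hr.ne'⟩
  have hperf : Preperfect U := hpre.preperfect_of_nontrivial hnt
  have hM : MeromorphicOn F U := hF.meromorphicOn
  have hord : ∀ u : U, meromorphicOrderAt F u ≠ ⊤ := by
    refine fun u => (hM.exists_meromorphicOrderAt_ne_top_iff_forall
      ⟨⟨_, h0U⟩, hpre⟩).1 ⟨⟨r, hrU⟩, ?_⟩ u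
    rw [(hF r hrU).meromorphicOrderAt_eq, (hF r hrU).analyticOrderAt_eq_zero.2 hrF]
    simp
  set D := MeromorphicOn.divisor F U with hD
  have hfin : D.support.Finite := D.finiteSupport (isCompact_closedBall 0 r)
  have hnn : 0 ≤ D := MeromorphicOn.AnalyticOnNhd.divisor_nonneg hF
  obtain ⟨g, hg, hg0, hfg⟩ := hM.extract_zeros_poles hord hfin
  have hprod : ∀ z, (∏ᶠ u, (· - u) ^ D u : ℂ → ℂ) z
      = ∏ a ∈ hfin.toFinset, (z - a) ^ (D a).toNat := by
    intro z
    rw [finprod_eq_prod_of_mulSupport_subset (s := hfin.toFinset), Finset.prod_apply]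
    · refine Finset.prod_congr rfl fun a _ => ?_
      rw [Pi.pow_apply, ← zpow_natCast, Int.toNat_of_nonneg (hnn a)]
    · simp [Function.FactorizedRational.mulSupport]
  have heq : ∀ z ∈ U, F z = (∏ a ∈ hfin.toFinset, (z - a) ^ (D a).toNat) * g z := by
    intro z hz
    have hA : AnalyticAt ℂ ((∏ᶠ u, (· - u) ^ D u : ℂ → ℂ) • g) z :=
      (Function.FactorizedRational.analyticAt (hnn z)).smul (hg z hz)
    have h1 := (hF z hz).meromorphicAt.eventuallyEq_nhdsNE_of_eventuallyEq_codiscreteWithin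
      hA.meromorphicAt hz (hperf z hz) hfg
    have h2 := ((hF z hz).continuousAt.eventuallyEq_nhds_iff_eventuallyEq_nhdsNE
      hA.continuousAt).1 h1
    have h3 := h2.self_of_nhds
    rw [h3, Pi.smul_apply', hprod, smul_eq_mul]
  refine ⟨hfin.toFinset, fun a => (D a).toNat, g, ?_, ?_, hg.continuousOn,
    fun z hz => hg0 ⟨z, hz⟩, heq⟩
  · intro a ha
    have haU : a ∈ U := by simpa [hU] using (hS a ha).1.le
    have h := heq a haU
    rw [(hS a ha).2, eq_comm, mul_eq_zero, or_iff_left (hg0 ⟨a, haU⟩), Finset.prod_eq_zero_iff] at h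
    obtain ⟨b, hb, hab⟩ := h
    have hab' : a - b = 0 := by by_contra h; exact pow_ne_zero _ h hab
    rwa [sub_eq_zero.1 hab']
  · intro a ha
    have haD : D a ≠ 0 := by simpa using ha
    have haU : a ∈ U := D.supportWithinDomain haD
    have h1 : 1 ≤ (D a).toNat := by have := hnn a; simp at this; omega
    refine ⟨lt_of_le_of_ne (by simpa [hU] using haU) fun h => hs a (by simpa using h) ?_, h1⟩
    rw [heq a haU, Finset.prod_eq_zero ha, zero_mul]
    rw [sub_self, zero_pow (by omega)]

/-- Zeros are bounded by the winding number: if a continuous logarithm `ℓ` of `F` along the circle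
of radius `r` is given, then the number of zeros inside is at most the increment of `ℓ`. -/
lemma two_pi_mul_card_le {r : ℝ} (hr : 0 < r) {F : ℂ → ℂ}
    (hF : AnalyticOnNhd ℂ F (closedBall 0 r)) {ℓ : ℝ → ℂ}
    (hℓ : ContinuousOn ℓ (Icc (-(1 / 2)) (1 / 2)))
    (hFℓ : ∀ x ∈ Icc (-(1 / 2) : ℝ) (1 / 2), F (r * exp (2 * Real.pi * I * x)) = exp (ℓ x))
    (S : Finset ℂ) (hS : ∀ a ∈ S, ‖a‖ < r ∧ F a = 0) :
    2 * Real.pi * S.card ≤ (ℓ (1 / 2) - ℓ (-(1 / 2))).im := by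
  have hcirc : ∀ x : ℝ, ‖(r : ℂ) * exp (2 * Real.pi * I * x)‖ = r := by
    intro x
    rw [norm_mul, norm_real, Real.norm_of_nonneg hr.le,
      show (2 * Real.pi * I * x : ℂ) = ((2 * Real.pi * x : ℝ) : ℂ) * I by push_cast; ring,
      norm_exp_ofReal_mul_I, mul_one]
  have hs : ∀ z ∈ sphere (0 : ℂ) r, F z ≠ 0 := by
    intro z hz
    have hz' : ‖z‖ = r := by simpa using hz
    have hx : arg z / (2 * Real.pi) ∈ Icc (-(1 / 2) : ℝ) (1 / 2) := by
      have := Real.pi_pos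
      have h1 := (neg_pi_lt_arg z).le
      have h2 := arg_le_pi z
      constructor
      · rw [le_div_iff₀ (by positivity)]; linarith
      · rw [div_le_iff₀ (by positivity)]; linarith
    have hzx : (r : ℂ) * exp (2 * Real.pi * I * (arg z / (2 * Real.pi) : ℝ)) = z := by
      have : (2 * Real.pi * I * (arg z / (2 * Real.pi) : ℝ) : ℂ) = arg z * I := by
        have := Real.pi_ne_zero
        push_cast
        field_simp
      rw [this, ← hz', norm_mul_exp_arg_mul_I]
    rw [← hzx, hFℓ _ hx]
    exact exp_ne_zero _
  obtain ⟨T, m, g, hST, hT, hgc, hg0, hfac⟩ := exists_zero_factorization hr hF hs S hS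
  obtain ⟨G, hG, hGe⟩ := exists_log_closedBall hr hgc hg0
  set q : ℝ → ℂ := fun x => r * exp (2 * Real.pi * I * x) with hq
  have hqc : Continuous q := by fun_prop
  have hqn : ∀ x, ‖q x‖ = r := hcirc
  have hq0 : ∀ x, q x ≠ 0 := fun x => norm_pos_iff.1 (by rw [hqn]; exact hr)
  have hslit : ∀ a ∈ T, ∀ x, 1 - a / q x ∈ slitPlane := by
    intro a ha x
    refine Or.inl ?_
    have h1 : ‖a / q x‖ < 1 := by
      rw [norm_div, hqn, div_lt_one hr]; exact (hT a ha).1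
    have := (re_le_norm (a / q x)).trans_lt h1
    simpa using this
  let Λ : ℝ → ℂ := fun x => ∑ a ∈ T, m a * (2 * Real.pi * I * x + log r + log (1 - a / q x))
    + G (q x)
  have hΛc : Continuous Λ := by
    refine Continuous.add (continuous_finsetSum _ fun a ha => ?_) (hG.comp hqc)
    refine continuous_const.mul (Continuous.add (by fun_prop) ?_)
    exact (continuous_const.sub (continuous_const.div hqc hq0)).clog (hslit a ha)
  have hΛe : ∀ x, exp (Λ x) = F (q x) := by
    intro x
    have hmem : q x ∈ closedBall (0 : ℂ) r := by simp [hqn]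
    rw [hfac _ hmem, exp_add, hGe _ hmem, exp_sum]
    congr 1
    refine Finset.prod_congr rfl fun a ha => ?_
    rw [exp_nat_mul, exp_add, exp_add, exp_log (by exact_mod_cast hr.ne'),
      exp_log (slitPlane_ne_zero (hslit a ha x)), mul_comm (exp _) (r : ℂ), mul_sub, mul_one]
    change (q x - q x * (a / q x)) ^ _ = _
    rw [mul_div_cancel₀ _ (hq0 x)]
  have hconst := eq_of_exp_eq_one (f := fun x => ℓ x - Λ x) (a := -(1 / 2)) (b := 1 / 2)
    (by norm_num) (hℓ.sub hΛc.continuousOn) (fun x hx => by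
      rw [exp_sub, ← hFℓ x hx, hΛe]
      exact div_self (by rw [← hΛe]; exact exp_ne_zero _))
  have hqq : q (1 / 2) = q (-(1 / 2)) := by
    simp only [hq]
    congr 1
    rw [exp_eq_exp_iff_exists_int]
    exact ⟨1, by push_cast; ring⟩
  have hdiff : ℓ (1 / 2) - ℓ (-(1 / 2)) = Λ (1 / 2) - Λ (-(1 / 2)) := by
    linear_combination -hconst
  have hΛd : Λ (1 / 2) - Λ (-(1 / 2)) = ((2 * Real.pi * ∑ a ∈ T, (m a : ℝ) : ℝ) : ℂ) * I := by
    simp only [Λ, hqq]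
    rw [add_sub_add_right_eq_sub, ← Finset.sum_sub_distrib]
    push_cast
    rw [Finset.mul_sum, Finset.sum_mul]
    refine Finset.sum_congr rfl fun a _ => ?_
    ring
  rw [hdiff, hΛd, im_ofReal_mul, I_im, mul_one]
  refine mul_le_mul_of_nonneg_left ?_ (by positivity)
  calc (S.card : ℝ) ≤ T.card := by exact_mod_cast Finset.card_le_card hST
    _ = ∑ a ∈ T, (1 : ℝ) := by simp
    _ ≤ ∑ a ∈ T, (m a : ℝ) := Finset.sum_le_sum fun a ha => by exact_mod_cast (hT a ha).2

lemma Ek_eq_E {k : ℕ} (hk : 3 ≤ k) (hke : Even k) (z : UpperHalfPlane) :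
    Ek k z = ModularForm.E hk z := by
  rw [EisensteinSeries.q_expansion_bernoulli hk hke, Ek]
  have hs := EisensteinSeries.summable_sigma_mul_cexp_pow (k := k) (by omega) z
  congr 2
  have : ∀ n : ℕ, (∑ d ∈ n.divisors, (d : ℂ) ^ (k - 1)) * exp (2 * Real.pi * I * z) ^ n
      = (ArithmeticFunction.sigma (k - 1) n : ℂ) * exp (2 * Real.pi * I * z) ^ n := by
    intro n
    rw [ArithmeticFunction.sigma_apply]
    push_cast
    rfl
  rw [tsum_congr this, ← tsum_zero_pnat_eq_tsum_nat hs]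
  simp

lemma Ek_add_one (k : ℕ) (z : ℂ) : Ek k (z + 1) = Ek k z := by
  have : exp (2 * Real.pi * I * (z + 1)) = exp (2 * Real.pi * I * z) := by
    rw [mul_add, mul_one, exp_add, exp_two_pi_mul_I, mul_one]
  rw [Ek, Ek, this]

lemma Ek_neg_inv {k : ℕ} (hk : 3 ≤ k) (hke : Even k) {z : ℂ} (hz : 0 < z.im) :
    Ek k ((-z)⁻¹) = z ^ k * Ek k z := by
  let w : UpperHalfPlane := ⟨z, hz⟩
  have h := SlashInvariantForm.slash_action_eqn'' (Γ := 𝒮ℒ) (ModularForm.E hk)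
    (γ := (ModularGroup.S : Matrix.GeneralLinearGroup (Fin 2) ℝ))
    ⟨ModularGroup.S, rfl⟩ w
  have h1 : (ModularGroup.S : Matrix.GeneralLinearGroup (Fin 2) ℝ) • w = ModularGroup.S • w := rfl
  rw [h1, ← Ek_eq_E hk hke, ← Ek_eq_E hk hke, UpperHalfPlane.modular_S_smul] at h
  have h2 : UpperHalfPlane.denom (ModularGroup.S : Matrix.GeneralLinearGroup (Fin 2) ℝ) w = z := by
    change (((ModularGroup.S 1 0 : ℤ) : ℝ) : ℂ) * z + (((ModularGroup.S 1 1 : ℤ) : ℝ) : ℂ) = z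
    simp [ModularGroup.S]
  rw [h2] at h
  simpa using h

lemma rho_sq : (1 / 2 + (Real.sqrt 3 / 2) * I : ℂ) ^ 2 = (1 / 2 + (Real.sqrt 3 / 2) * I) - 1 := by
  have : ((Real.sqrt 3 : ℝ) : ℂ) ^ 2 = 3 := by
    rw [← ofReal_pow, Real.sq_sqrt (by norm_num)]; norm_num
  linear_combination (-1 / 4 : ℂ) * this + (1 / 4 : ℂ) * (Real.sqrt 3 : ℂ) ^ 2 * I_sq

lemma deriv_Ek_rho_eq_zero {k : ℕ} (hk : 3 ≤ k) (hke : Even k) (h6 : k % 6 = 2) :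
    deriv (Ek k) (1 / 2 + (Real.sqrt 3 / 2) * I) = 0 := by
  set ρ : ℂ := 1 / 2 + (Real.sqrt 3 / 2) * I with hρ
  have h2 : ρ ^ 2 = ρ - 1 := rho_sq
  have him : 0 < ρ.im := by
    have : ρ.im = Real.sqrt 3 / 2 := by simp [hρ]
    rw [this]; positivity
  have h0 : ρ ≠ 0 := fun h => by simp [h] at him
  have hinv : (-ρ)⁻¹ = ρ - 1 := by
    rw [inv_eq_iff_eq_inv, eq_comm, inv_eq_iff_eq_inv]
    rw [eq_comm]
    apply inv_eq_of_mul_eq_one_left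
    linear_combination -h2
  have h6' : ρ ^ 6 = 1 := by
    linear_combination (ρ ^ 4 + ρ ^ 3 - ρ - 1) * h2
  obtain ⟨m, hm⟩ : ∃ m, k = 6 * m + 2 := ⟨k / 6, by omega⟩
  have hpow : ρ ^ k = ρ - 1 := by rw [hm, pow_add, pow_mul, h6', one_pow, one_mul, h2]
  have hval : Ek k ρ = 0 := by
    have := Ek_neg_inv hk hke him
    rw [hinv, ← Ek_add_one, sub_add_cancel, hpow] at this
    have h3 : (ρ - 2) * Ek k ρ = 0 := by linear_combination -this
    refine (mul_eq_zero.1 h3).resolve_left fun h => ?_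
    have : (ρ - 2).im = ρ.im := by simp
    rw [h] at this
    simp at this
    linarith
  have hF := (hasDerivAt_Ek hk him).differentiableAt.hasDerivAt
  set D := deriv (Ek k) ρ
  have hg : HasDerivAt (fun z : ℂ => (-z)⁻¹ + 1) ((-ρ)⁻¹ ^ 2) ρ := by
    have := ((hasDerivAt_id ρ).neg.inv (neg_ne_zero.2 h0)).add_const 1
    refine this.congr_deriv ?_
    simp
  have hgρ : (-ρ)⁻¹ + 1 = ρ := by rw [hinv]; ring
  have hl : HasDerivAt (fun z => Ek k ((-z)⁻¹ + 1)) (D * (-ρ)⁻¹ ^ 2) ρ := by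
    have hF' : HasDerivAt (Ek k) D ((-ρ)⁻¹ + 1) := by rw [hgρ]; exact hF
    exact HasDerivAt.comp (h₂ := Ek k) ρ hF' hg
  have hr : HasDerivAt (fun z => z ^ k * Ek k z) (k * ρ ^ (k - 1) * Ek k ρ + ρ ^ k * D) ρ :=
    (hasDerivAt_pow k ρ).mul hF
  have heq : (fun z => Ek k ((-z)⁻¹ + 1)) =ᶠ[nhds ρ] fun z => z ^ k * Ek k z := by
    filter_upwards [(isOpen_lt continuous_const continuous_im).mem_nhds him] with z hz
    rw [Ek_add_one, Ek_neg_inv hk hke hz]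
  have key := hl.unique (hr.congr_of_eventuallyEq heq)
  rw [hval, hpow, hinv] at key
  have h4 : (1 - 2 * ρ) * D = 0 := by linear_combination key - D * h2
  refine (mul_eq_zero.1 h4).resolve_left fun h => ?_
  have : (1 - 2 * ρ).im = -2 * ρ.im := by simp
  rw [h] at this
  simp at this
  linarith

lemma hasSum_inv_mul_succ : HasSum (fun n : ℕ => 1 / (((n : ℝ) + 1) * (n + 2))) 1 := by
  rw [hasSum_iff_tendsto_nat_of_nonneg (fun n => by positivity)]
  have h : ∀ n : ℕ, ∑ i ∈ Finset.range n, 1 / (((i : ℝ) + 1) * (i + 2)) = 1 - 1 / ((n : ℝ) + 1) := by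
    intro n
    induction n with
    | zero => simp
    | succ n ih =>
      rw [Finset.sum_range_succ, ih]
      push_cast
      field_simp
      ring
  simp_rw [h]
  simpa using tendsto_const_nhds.sub (tendsto_one_div_add_atTop_nhds_zero_nat (𝕜 := ℝ))

/-- A two-sided series is close to its two central terms `g 0` and `g (-1)`. -/
lemma norm_int_tsum_sub_le {g : ℤ → ℂ} {b₁ b₂ : ℕ → ℝ} {B₁ B₂ : ℝ} (h₁ : HasSum b₁ B₁)
    (h₂ : HasSum b₂ B₂) (hg₁ : ∀ n : ℕ, ‖g ((n : ℤ) + 1)‖ ≤ b₁ n)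
    (hg₂ : ∀ n : ℕ, ‖g (-((n : ℤ) + 2))‖ ≤ b₂ n) :
    ‖∑' d : ℤ, g d - (g 0 + g (-1))‖ ≤ B₁ + B₂ := by
  have s₁ : Summable fun n : ℕ => g ((n : ℤ) + 1) := Summable.of_norm_bounded h₁.summable hg₁
  have s₂ : Summable fun n : ℕ => g (-((n : ℤ) + 2)) := Summable.of_norm_bounded h₂.summable hg₂
  have t₁ : Summable fun n : ℕ => g (n : ℤ) := by
    rw [← summable_nat_add_iff 1]
    exact_mod_cast s₁
  have t₂ : Summable fun n : ℕ => g (-((n : ℤ) + 1)) := by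
    rw [← summable_nat_add_iff 1]
    refine s₂.congr fun n => ?_
    push_cast
    ring_nf
  rw [tsum_of_nat_of_neg_add_one t₁ t₂, t₁.tsum_eq_zero_add, t₂.tsum_eq_zero_add]
  have e₁ : ∑' n : ℕ, g ((n + 1 : ℕ) : ℤ) = ∑' n : ℕ, g ((n : ℤ) + 1) :=
    tsum_congr fun n => by push_cast; rfl
  have e₂ : ∑' n : ℕ, g (-(((n + 1 : ℕ) : ℤ) + 1)) = ∑' n : ℕ, g (-((n : ℤ) + 2)) :=
    tsum_congr fun n => by push_cast; ring_nf
  rw [e₁, e₂]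
  have : g ((0 : ℕ) : ℤ) + ∑' n : ℕ, g ((n : ℤ) + 1) + (g (-(((0 : ℕ) : ℤ) + 1))
      + ∑' n : ℕ, g (-((n : ℤ) + 2))) - (g 0 + g (-1))
      = ∑' n : ℕ, g ((n : ℤ) + 1) + ∑' n : ℕ, g (-((n : ℤ) + 2)) := by
    simp; ring
  rw [this]
  exact (norm_add_le _ _).trans (add_le_add (tsum_of_norm_bounded h₁ hg₁)
    (tsum_of_norm_bounded h₂ hg₂))

lemma one_add_mul_le_pow_of_sq {s B : ℝ} (hs : 0 ≤ s) (hB : 0 ≤ B) (h : 1 + B ≤ s ^ 2) {K : ℕ}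
    (hK : 2 ≤ K) : 1 + K / 2 * B ≤ s ^ K := by
  have hK' : (1 : ℝ) ≤ K / 2 := by
    rw [le_div_iff₀ (by norm_num)]; exact_mod_cast (by omega : 1 * 2 ≤ K)
  calc 1 + K / 2 * B ≤ (1 + B) ^ ((K : ℝ) / 2) :=
        one_add_mul_self_le_rpow_one_add (by linarith) hK'
    _ ≤ (s ^ 2) ^ ((K : ℝ) / 2) := Real.rpow_le_rpow (by linarith) h (by linarith)
    _ = s ^ K := by
        rw [← Real.rpow_natCast s 2, ← Real.rpow_mul hs, ← Real.rpow_natCast]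
        congr 1; push_cast; ring

lemma norm_div_pow_le {z w : ℂ} {A : ℝ} (hA : 0 < A) {K : ℕ}
    (h : A ≤ (‖w‖ / ‖z‖) ^ K) : ‖(z / w) ^ K‖ ≤ 1 / A := by
  rw [norm_pow, norm_div, ← inv_div, inv_pow, ← one_div]
  exact one_div_le_one_div_of_le hA h

/-- Each row `c ≥ 2` of the lattice sum is small. -/
lemma norm_row_le {z : ℂ} {K : ℕ} (hK : 9 ≤ K) (hz : z ≠ 0) (hy : 2 / 3 * ‖z‖ ^ 2 ≤ z.im ^ 2)
    (hX : ‖z‖ ^ 2 ≤ K / 4) {c : ℕ} (hc : 2 ≤ c) :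
    ‖(c : ℂ) * ∑' d : ℤ, (z / (c * z + d)) ^ K‖ ≤ 5 / 2 * (1 / (c : ℝ) ^ 4) := by
  have hc' : (2 : ℝ) ≤ c := by exact_mod_cast hc
  have hzn : 0 < ‖z‖ := norm_pos_iff.2 hz
  set X := ‖z‖ ^ 2 with hXdef
  have hX0 : 0 < X := by positivity
  have hK' : (0 : ℝ) < K := by exact_mod_cast (by omega : 0 < K)
  have hterm : ∀ d : ℤ, ‖(z / (c * z + d)) ^ K‖
      ≤ (1 / ((102 / 125 * c) ^ 9)) * (c ^ 2 / (c ^ 2 + 3 * (c * z.re + d) ^ 2)) := by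
    intro d
    set e : ℝ := c * z.re + d with he
    have hsq : ‖(c : ℂ) * z + d‖ ^ 2 = e ^ 2 + c ^ 2 * z.im ^ 2 := by
      rw [← normSq_eq_norm_sq, normSq_apply]
      simp [he]; ring
    have hs : (102 / 125 * c : ℝ) ^ 2 * (1 + 3 / 2 * e ^ 2 / (c ^ 2 * X))
        ≤ (‖(c : ℂ) * z + d‖ / ‖z‖) ^ 2 := by
      rw [div_pow, hsq, le_div_iff₀ hX0]
      have : (102 / 125 * c : ℝ) ^ 2 * (1 + 3 / 2 * e ^ 2 / (c ^ 2 * X)) * X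
          = (102 / 125) ^ 2 * (c ^ 2 * X + 3 / 2 * e ^ 2) := by
        field_simp
      rw [this]
      have h1 : 2 / 3 * (c ^ 2 * X) ≤ c ^ 2 * z.im ^ 2 := by nlinarith [sq_nonneg (c : ℝ)]
      have h2 : 0 ≤ (c : ℝ) ^ 2 * X := by positivity
      nlinarith [sq_nonneg e]
    have hγ : (0 : ℝ) < 102 / 125 * c := by positivity
    have hγ1 : (1 : ℝ) ≤ 102 / 125 * c := by linarith
    have hB : (0 : ℝ) ≤ 3 / 2 * e ^ 2 / (c ^ 2 * X) := by positivity
    have hb := one_add_mul_le_pow_of_sq (s := ‖(c : ℂ) * z + d‖ / ‖z‖ / (102 / 125 * c))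
      (by positivity) hB (by rw [div_pow, le_div_iff₀ (by positivity)]; linarith) (K := K) (by omega)
    have hb2 : 1 + 3 * e ^ 2 / c ^ 2 ≤ 1 + (K : ℝ) / 2 * (3 / 2 * e ^ 2 / (c ^ 2 * X)) := by
      have : (K : ℝ) / 2 * (3 / 2 * e ^ 2 / (c ^ 2 * X)) = 3 * e ^ 2 / c ^ 2 * ((K / 4) / X) := by
        field_simp; ring
      rw [this]
      have h1 : 1 ≤ (K / 4 : ℝ) / X := by rwa [le_div_iff₀ hX0, one_mul]
      have h2 : 0 ≤ 3 * e ^ 2 / (c : ℝ) ^ 2 := by positivity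
      nlinarith
    have hfin : (102 / 125 * c : ℝ) ^ 9 * (1 + 3 * e ^ 2 / c ^ 2)
        ≤ (‖(c : ℂ) * z + d‖ / ‖z‖) ^ K := by
      rw [div_pow (_ / _) _ K, le_div_iff₀ (by positivity)] at hb
      calc (102 / 125 * c : ℝ) ^ 9 * (1 + 3 * e ^ 2 / c ^ 2)
          ≤ (102 / 125 * c : ℝ) ^ K * (1 + (K : ℝ) / 2 * (3 / 2 * e ^ 2 / (c ^ 2 * X))) := by
            gcongr
        _ ≤ _ := by linarith
    refine (norm_div_pow_le (by positivity) hfin).trans (le_of_eq ?_)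
    field_simp
  have hsum6 : HasSum (fun n : ℕ => 1 / ((102 / 125 * c : ℝ) ^ 9) * (c ^ 2 / 3 * (1 / ((n : ℝ) + 1) ^ 2)))
      (1 / ((102 / 125 * c : ℝ) ^ 9) * (c ^ 2 / 3 * (Real.pi ^ 2 / 6))) := by
    have := hasSum_zeta_two
    rw [← hasSum_nat_add_iff' 1] at this
    refine HasSum.mul_left _ ?_
    simpa using this.mul_left ((c : ℝ) ^ 2 / 3)
  set p : ℤ := -⌊c * z.re⌋ with hp
  set f : ℝ := Int.fract (c * z.re) with hf
  have hf0 : 0 ≤ f := Int.fract_nonneg _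
  have hf1 : f < 1 := Int.fract_lt_one _
  have hfp : ∀ j : ℤ, (c : ℝ) * z.re + (j + p : ℤ) = f + j := by
    intro j
    have := Int.fract_add_floor ((c : ℝ) * z.re)
    push_cast [hp]
    rw [← hf] at this
    linarith
  have hshift : ∑' d : ℤ, (z / (c * z + d)) ^ K = ∑' j : ℤ, (z / (c * z + (j + p : ℤ))) ^ K :=
    ((Equiv.addRight p).tsum_eq fun d : ℤ => (z / (c * z + d)) ^ K).symm
  set g : ℤ → ℂ := fun j => (z / (c * z + (j + p : ℤ))) ^ K with hg
  set M : ℝ := 1 / ((102 / 125 * c) ^ 9) with hM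
  have hM0 : 0 < M := by positivity
  have hgb : ∀ j : ℤ, ‖g j‖ ≤ M * (c ^ 2 / (c ^ 2 + 3 * (f + j) ^ 2)) := by
    intro j
    have := hterm (j + p)
    rwa [hfp] at this
  have hgt : ∀ (j : ℤ), ‖g j‖ ≤ M := fun j => (hgb j).trans
    (mul_le_of_le_one_right hM0.le ((div_le_one (by positivity)).2 (by nlinarith [sq_nonneg (f + j)])))
  have hgn : ∀ (j : ℤ) (n : ℕ), ((n : ℝ) + 1) ^ 2 ≤ (f + j) ^ 2 →
      ‖g j‖ ≤ M * (c ^ 2 / 3 * (1 / ((n : ℝ) + 1) ^ 2)) := by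
    intro j n h
    refine (hgb j).trans (mul_le_mul_of_nonneg_left ?_ hM0.le)
    rw [div_mul_div_comm, mul_one]
    refine div_le_div_of_nonneg_left (by positivity) (by positivity) ?_
    nlinarith [sq_nonneg (c : ℝ)]
  have hmain := norm_int_tsum_sub_le (g := g) hsum6 hsum6
    (fun n => hgn _ n (by
      push_cast
      have : (0 : ℝ) ≤ n := n.cast_nonneg
      nlinarith))
    (fun n => hgn _ n (by
      push_cast
      have : (0 : ℝ) ≤ n := n.cast_nonneg
      nlinarith))
  have htot : ‖∑' j : ℤ, g j‖ ≤ M * (2 + 2 * (c ^ 2 / 3 * (Real.pi ^ 2 / 6))) := by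
    have h1 : ‖∑' j : ℤ, g j‖ ≤ ‖∑' j : ℤ, g j - (g 0 + g (-1))‖ + (‖g 0‖ + ‖g (-1)‖) := by
      refine le_trans ?_ (add_le_add_right (norm_add_le _ _) _)
      refine le_trans ?_ (norm_add_le _ _)
      rw [sub_add_cancel]
    linarith [hgt 0, hgt (-1)]
  have hpi : Real.pi ^ 2 < 9.87 := by
    have := Real.pi_lt_d4
    have := Real.pi_pos
    nlinarith
  rw [norm_mul, Complex.norm_natCast, hshift]
  calc (c : ℝ) * ‖∑' j : ℤ, g j‖ ≤ c * (M * (8 / 5 * c ^ 2)) := by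
        gcongr
        refine htot.trans ?_
        gcongr
        nlinarith
    _ = (8 / 5 * (125 / 102) ^ 9) * (1 / (c : ℝ) ^ 2) * (1 / (c : ℝ) ^ 4) := by
        rw [hM]; field_simp
    _ ≤ (8 / 5 * (125 / 102) ^ 9) * (1 / (2 : ℝ) ^ 2) * (1 / (c : ℝ) ^ 4) := by gcongr
    _ ≤ 5 / 2 * (1 / (c : ℝ) ^ 4) := by
        gcongr; norm_num

/-- The lattice sum normalised at `z`, in terms of the `q`-series. -/
noncomputable def latticeSum (k : ℕ) (z : ℂ) : ℂ :=
  z ^ (k + 1) * ((-2 * Real.pi * I) ^ (k + 1) / k.factorial *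
    derivSeries k (exp (2 * Real.pi * I * z)))

/-- The terms `c = 1`, `d = 0, -1` dominate the lattice sum. -/
lemma norm_latticeSum_sub_le {k : ℕ} (hk : 8 ≤ k) {z : ℂ} (hz : 0 < z.im)
    (hy : 2 / 3 * ‖z‖ ^ 2 ≤ z.im ^ 2) (hX : ‖z‖ ^ 2 ≤ ((k + 1 : ℕ) : ℝ) / 4) {β₁ β₂ : ℝ}
    (h₁ : ∀ n : ℕ, ‖(z / (z + (n + 1))) ^ (k + 1)‖ ≤ β₁ * (1 / (((n : ℝ) + 1) * (n + 2))))
    (h₂ : ∀ n : ℕ, ‖(z / (z - (n + 2))) ^ (k + 1)‖ ≤ β₂ * (1 / (((n : ℝ) + 1) * (n + 2)))) :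
    ‖latticeSum k z - (1 + (z / (z - 1)) ^ (k + 1))‖ ≤ β₁ + β₂ + 1 / 4 := by
  have hz0 : z ≠ 0 := fun h => by simp [h] at hz
  have hs : HasSum (fun c : ℕ+ => (c : ℂ) * ∑' d : ℤ, (z / (c * z + d)) ^ (k + 1))
      (latticeSum k z) := by
    have h := (derivSeries_eq_lattice (k := k) (by omega) hz).mul_left (z ^ (k + 1))
    have hf : (fun c : ℕ+ => (c : ℂ) * ∑' d : ℤ, (z / (c * z + d)) ^ (k + 1)) = fun c : ℕ+ =>
        z ^ (k + 1) * ((c : ℂ) * ∑' d : ℤ, 1 / (c * z + d) ^ (k + 1)) := by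
      funext c
      rw [mul_left_comm, ← tsum_mul_left (a := z ^ (k + 1))]
      congr 1
      exact tsum_congr fun d => by rw [div_pow, mul_one_div]
    rw [hf]
    exact h
  have hs2 : HasSum (fun n : ℕ => ((n + 1 : ℕ) : ℂ) *
      ∑' d : ℤ, (z / (((n + 1 : ℕ) : ℂ) * z + d)) ^ (k + 1)) (latticeSum k z) := by
    rw [← Equiv.pnatEquivNat.symm.hasSum_iff] at hs
    exact hs
  have hrow : ‖∑' d : ℤ, (z / (z + d)) ^ (k + 1) - (1 + (z / (z - 1)) ^ (k + 1))‖ ≤ β₁ + β₂ := by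
    have := norm_int_tsum_sub_le (g := fun d : ℤ => (z / (z + d)) ^ (k + 1))
      (hasSum_inv_mul_succ.mul_left β₁) (hasSum_inv_mul_succ.mul_left β₂)
      (fun n => by simpa using h₁ n)
      (fun n => by
        have := h₂ n
        rw [show z - ((n : ℂ) + 2) = z + ((-((n : ℤ) + 2) : ℤ) : ℂ) by push_cast; ring] at this
        exact this)
    simpa [div_self hz0, ← sub_eq_add_neg] using this
  have htail : HasSum (fun n : ℕ => 5 / 2 * (1 / ((n + 2 : ℕ) : ℝ) ^ 4))
      (5 / 2 * (Real.pi ^ 4 / 90 - 1)) := by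
    have := hasSum_zeta_four
    rw [← hasSum_nat_add_iff' 2] at this
    refine HasSum.mul_left _ ?_
    simpa [Finset.sum_range_succ] using this
  have hpi : 5 / 2 * (Real.pi ^ 4 / 90 - 1) ≤ 1 / 4 := by
    have h1 := Real.pi_lt_d4
    have h2 : Real.pi ^ 2 < 9.87 := by nlinarith [Real.pi_pos]
    have : Real.pi ^ 4 = Real.pi ^ 2 * Real.pi ^ 2 := by ring
    nlinarith [sq_nonneg Real.pi]
  have hs3 := (hasSum_nat_add_iff' 1).2 hs2
  have hs4 := tsum_of_norm_bounded htail fun n => norm_row_le (z := z) (K := k + 1) (by omega) hz0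
    hy hX (c := n + 2) (by omega)
  rw [hs3.tsum_eq] at hs4
  simp only [Finset.sum_range_one, zero_add, Nat.cast_one, one_mul] at hs4
  calc ‖latticeSum k z - (1 + (z / (z - 1)) ^ (k + 1))‖
      = ‖(latticeSum k z - ∑' d : ℤ, (z / (z + d)) ^ (k + 1))
        + (∑' d : ℤ, (z / (z + d)) ^ (k + 1) - (1 + (z / (z - 1)) ^ (k + 1)))‖ := by
          rw [sub_add_sub_cancel]
    _ ≤ _ := norm_add_le _ _
    _ ≤ β₁ + β₂ + 1 / 4 := by linarith

lemma derivSeries_conj (k : ℕ) (q : ℂ) :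
    derivSeries k (starRingEnd ℂ q) = starRingEnd ℂ (derivSeries k q) := by
  rw [derivSeries, derivSeries, conj_tsum]
  simp

lemma latticeSum_neg_conj (k : ℕ) (z : ℂ) :
    latticeSum k (-starRingEnd ℂ z) = starRingEnd ℂ (latticeSum k z) := by
  have hq : exp (2 * Real.pi * I * (-starRingEnd ℂ z))
      = starRingEnd ℂ (exp (2 * Real.pi * I * z)) := by
    rw [← exp_conj]
    congr 1
    simp only [map_mul, conj_I, conj_ofReal, map_ofNat]
    ring
  have h2 : -2 * Real.pi * I * (-starRingEnd ℂ z) = starRingEnd ℂ (-2 * Real.pi * I * z) := by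
    simp only [map_mul, map_neg, conj_I, conj_ofReal, map_ofNat]
    ring
  have hl : ∀ w : ℂ, latticeSum k w = (-2 * Real.pi * I * w) ^ (k + 1) / k.factorial *
      derivSeries k (exp (2 * Real.pi * I * w)) := by
    intro w
    rw [latticeSum, mul_pow _ w]
    ring
  rw [hl, hl, hq, h2, derivSeries_conj]
  simp

lemma norm_pow_sub_pow_le_mul {a b : ℂ} (ha : ‖a‖ ≤ 1) (hb : ‖b‖ ≤ 1) (n : ℕ) :
    ‖a ^ n - b ^ n‖ ≤ n * ‖a - b‖ := by
  induction n with
  | zero => simp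
  | succ n ih =>
    have h : a ^ (n + 1) - b ^ (n + 1) = (a ^ n - b ^ n) * a + b ^ n * (a - b) := by ring
    rw [h]
    refine (norm_add_le _ _).trans ?_
    rw [norm_mul, norm_mul, norm_pow]
    have h1 : ‖a ^ n - b ^ n‖ * ‖a‖ ≤ n * ‖a - b‖ :=
      (mul_le_of_le_one_right (norm_nonneg _) ha).trans ih
    have h2 : ‖b‖ ^ n * ‖a - b‖ ≤ ‖a - b‖ :=
      mul_le_of_le_one_left (norm_nonneg _) (pow_le_one₀ (norm_nonneg _) hb)
    push_cast
    linarith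

lemma re_div_sub_one_pow_ge {K : ℕ} (hK : 9 ≤ K) {x y : ℝ} (hx0 : 0 ≤ x) (hx : x ≤ 1 / 2)
    (hy : 0 < y) (hy1 : 1 / 2 ≤ y ^ 2) (hy2 : y ^ 2 ≤ 3 / 4)
    (hre : 0 ≤ (((1 / 2 + y * I) / (1 / 2 + y * I - 1)) ^ K : ℂ).re) :
    -(1 / 2) ≤ (((x + y * I) / (x + y * I - 1)) ^ K : ℂ).re := by
  have hK' : (9 : ℝ) ≤ K := by exact_mod_cast hK
  have hn0 : ‖(x + y * I : ℂ)‖ ^ 2 = x ^ 2 + y ^ 2 := by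
    rw [← normSq_eq_norm_sq, normSq_apply]; simp; ring
  have hn1 : ‖(x + y * I - 1 : ℂ)‖ ^ 2 = (1 - x) ^ 2 + y ^ 2 := by
    rw [← normSq_eq_norm_sq, normSq_apply]; simp; ring
  have hnz0 : 0 < ‖(x + y * I : ℂ)‖ := by
    by_contra h
    have := le_antisymm (not_lt.1 h) (norm_nonneg _)
    rw [this] at hn0; nlinarith
  have hnz1 : 0 < ‖(x + y * I - 1 : ℂ)‖ := by
    by_contra h
    have := le_antisymm (not_lt.1 h) (norm_nonneg _)
    rw [this] at hn1; nlinarith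
  set δ := 1 / 2 - x with hδ
  have hδ0 : 0 ≤ δ := by linarith
  rcases lt_or_ge δ (1 / K) with hlt | hge
  · set N : ℝ := (1 - x) ^ 2 + y ^ 2 with hN
    have hN0 : 3 / 4 ≤ N := by nlinarith
    set s : ℝ := (y ^ 2 + 1 / 4) / N with hs
    have hs0 : 0 ≤ s := by positivity
    have hs1 : s ≤ 1 := by rw [hs, div_le_one (by linarith)]; nlinarith
    set ζ : ℂ := (x + y * I) / (x + y * I - 1) with hζ
    set ζ₀ : ℂ := (1 / 2 + y * I) / (1 / 2 + y * I - 1) with hζ₀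
    have h1 : ζ = ((δ ^ 2 - 1 / 4 + y ^ 2 : ℝ) - y * I) / N := by
      have hNc : (N : ℂ) ≠ 0 := by exact_mod_cast (by linarith : N ≠ 0)
      rw [hζ, div_eq_div_iff (norm_pos_iff.1 hnz1) hNc, hN, hδ]
      push_cast
      linear_combination (y : ℂ) ^ 2 * I_sq
    have h2 : ζ₀ = ((y ^ 2 - 1 / 4 : ℝ) - y * I) / (y ^ 2 + 1 / 4 : ℝ) := by
      have hNc : ((y ^ 2 + 1 / 4 : ℝ) : ℂ) ≠ 0 := by exact_mod_cast (by positivity)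
      have hd : (1 / 2 + y * I - 1 : ℂ) ≠ 0 := fun h => by
        have := congrArg im h
        simp at this; exact hy.ne' this
      rw [hζ₀, div_eq_div_iff hd hNc]
      push_cast
      linear_combination (y : ℂ) ^ 2 * I_sq
    have h3 : ζ - s * ζ₀ = ((δ ^ 2 / N : ℝ) : ℂ) := by
      have hNc : (N : ℂ) ≠ 0 := by exact_mod_cast (by linarith : N ≠ 0)
      have hMc : ((y ^ 2 + 1 / 4 : ℝ) : ℂ) ≠ 0 := by exact_mod_cast (by positivity)
      have hsm : (s : ℂ) * ζ₀ = ((y ^ 2 - 1 / 4 : ℝ) - y * I) / N := by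
        rw [hs, h2, ofReal_div, div_mul_div_comm, mul_comm, mul_div_mul_right _ _ hMc]
      rw [h1, hsm, ← sub_div]
      push_cast
      ring
    have hζ1 : ‖ζ‖ ≤ 1 := by
      rw [hζ, norm_div, div_le_one hnz1]
      refine abs_le_of_sq_le_sq' ?_ hnz1.le |>.2
      rw [hn0, hn1]
      nlinarith
    have hζ₀1 : ‖(s : ℂ) * ζ₀‖ ≤ 1 := by
      have : ‖ζ₀‖ = 1 := by
        have hsub : (1 / 2 + y * I - 1 : ℂ) = -starRingEnd ℂ (1 / 2 + y * I) := by
          simp only [map_add, map_div₀, map_mul, conj_I, conj_ofReal, map_one, map_ofNat]; ring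
        rw [hζ₀, hsub, norm_div, norm_neg, norm_conj, div_self]
        intro h
        have := congrArg im (norm_eq_zero.1 h)
        simp at this; exact hy.ne' this
      rw [norm_mul, norm_real, Real.norm_of_nonneg hs0, this, mul_one]
      exact hs1
    have h4 := norm_pow_sub_pow_le_mul hζ1 hζ₀1 K
    rw [h3, norm_real, Real.norm_of_nonneg (by positivity)] at h4
    have h5 : K * (δ ^ 2 / N) ≤ 4 / 27 := by
      have hKδ : K * δ ≤ 1 := by
        rw [lt_div_iff₀ (by linarith)] at hlt; linarith
      have hδ9 : δ ≤ 1 / 9 := by nlinarith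
      rw [← mul_div_assoc, div_le_iff₀ (by linarith)]
      nlinarith
    have h6 : ((ζ ^ K - (s * ζ₀) ^ K : ℂ)).re ≥ -(4 / 27) := by
      have := (abs_le.1 (abs_re_le_norm (ζ ^ K - (s * ζ₀) ^ K))).1
      linarith
    have h7 : ((s * ζ₀ : ℂ) ^ K).re = s ^ K * (ζ₀ ^ K).re := by
      rw [mul_pow, ← ofReal_pow, re_ofReal_mul]
    rw [sub_re, h7] at h6
    have h8 : 0 ≤ s ^ K * (ζ₀ ^ K).re := mul_nonneg (by positivity) hre
    linarith
  · have h1 : 1 + 2 * δ ≤ (‖(x + y * I - 1 : ℂ)‖ / ‖(x + y * I : ℂ)‖) ^ 2 := by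
      rw [div_pow, hn0, hn1, le_div_iff₀ (by positivity), hδ]
      have hX : x ^ 2 + y ^ 2 ≤ 1 := by nlinarith
      nlinarith
    have h2 := one_add_mul_le_pow_of_sq (by positivity) (by positivity) h1 (K := K) (by omega)
    have h3 : (2 : ℝ) ≤ 1 + K / 2 * (2 * δ) := by
      rw [div_le_iff₀ (by linarith)] at hge; linarith
    have h4 := norm_div_pow_le (by norm_num) (h3.trans h2)
    have h5 := (abs_le.1 (abs_re_le_norm (((x + y * I) / (x + y * I - 1)) ^ K : ℂ))).1
    linarith

lemma re_latticeSum_pos_of_nonneg {k : ℕ} (hk : 8 ≤ k) {x y : ℝ} (hx0 : 0 ≤ x) (hx : x ≤ 1 / 2)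
    (hy : 0 < y) (hy1 : 1 / 2 ≤ y ^ 2) (hy2 : y ^ 2 ≤ 3 / 4)
    (hre : 0 ≤ (((1 / 2 + y * I) / (1 / 2 + y * I - 1)) ^ (k + 1) : ℂ).re) :
    0 < (latticeSum k (x + y * I)).re := by
  set z : ℂ := x + y * I with hz
  have him : z.im = y := by simp [hz]
  have hn : ‖z‖ ^ 2 = x ^ 2 + y ^ 2 := by
    rw [← normSq_eq_norm_sq, normSq_apply]; simp [hz]; ring
  have hn1 : ‖z‖ ^ 2 ≤ 1 := by rw [hn]; nlinarith
  have hnz : 0 < ‖z‖ := by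
    by_contra h
    have := le_antisymm (not_lt.1 h) (norm_nonneg _)
    rw [this] at hn; nlinarith
  have hk' : (8 : ℝ) ≤ k := by exact_mod_cast hk
  have hbound : ∀ (w : ℂ) (m A : ℝ), 0 ≤ m → 0 < A → ‖w‖ ^ 2 ≥ ‖z‖ ^ 2 + m → A ≤ (1 + m) ^ 4 →
      ‖(z / w) ^ (k + 1)‖ ≤ 1 / A := by
    intro w m A hm hA hw hAm
    have h1 : 1 + m ≤ (‖w‖ / ‖z‖) ^ 2 := by
      rw [div_pow, le_div_iff₀ (by positivity)]; nlinarith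
    have h2 : 1 ≤ ‖w‖ / ‖z‖ := by
      by_contra h
      have h3 : 0 ≤ ‖w‖ / ‖z‖ := by positivity
      nlinarith
    refine norm_div_pow_le hA (hAm.trans ?_)
    calc (1 + m) ^ 4 ≤ ((‖w‖ / ‖z‖) ^ 2) ^ 4 := pow_le_pow_left₀ (by linarith) h1 4
      _ = (‖w‖ / ‖z‖) ^ 8 := by ring
      _ ≤ (‖w‖ / ‖z‖) ^ (k + 1) := pow_le_pow_right₀ h2 (by omega)
  have hmain := norm_latticeSum_sub_le hk (z := z) (by rw [him]; exact hy)
    (by rw [him, hn]; nlinarith) (by push_cast; linarith) (β₁ := 1 / 8) (β₂ := 1 / 40)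
    (fun n => by
      have hn' : (0 : ℝ) ≤ n := n.cast_nonneg
      refine (hbound _ (((n : ℝ) + 1) ^ 2) (8 * (((n : ℝ) + 1) * (n + 2))) (by positivity)
        (by positivity) ?_ ?_).trans (le_of_eq (by field_simp))
      · rw [← normSq_eq_norm_sq, normSq_apply, hn]; simp [hz]; nlinarith
      · nlinarith [pow_nonneg hn' 2, pow_nonneg hn' 3, pow_nonneg hn' 4, pow_nonneg hn' 5,
          pow_nonneg hn' 6, pow_nonneg hn' 7, pow_nonneg hn' 8])
    (fun n => by
      have hn' : (0 : ℝ) ≤ n := n.cast_nonneg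
      refine (hbound _ (((n : ℝ) + 1) * (n + 2)) (40 * (((n : ℝ) + 1) * (n + 2))) (by positivity)
        (by positivity) ?_ ?_).trans (le_of_eq (by field_simp))
      · rw [← normSq_eq_norm_sq, normSq_apply, hn]; simp [hz]; nlinarith
      · have hm : 2 ≤ ((n : ℝ) + 1) * (n + 2) := by nlinarith
        generalize ((n : ℝ) + 1) * (n + 2) = m at hm
        nlinarith [pow_nonneg (sub_nonneg.2 hm) 2, pow_nonneg (sub_nonneg.2 hm) 3,
          pow_nonneg (sub_nonneg.2 hm) 4])
  have h1 := (abs_le.1 ((abs_re_le_norm _).trans hmain)).1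
  have h2 := re_div_sub_one_pow_ge (K := k + 1) (by omega) hx0 hx hy hy1 hy2 hre
  rw [← hz] at h2
  rw [sub_re, add_re, one_re] at h1
  linarith

lemma re_latticeSum_pos {k : ℕ} (hk : 8 ≤ k) {x y : ℝ} (hx0 : -(1 / 2) ≤ x) (hx : x ≤ 1 / 2)
    (hy : 0 < y) (hy1 : 1 / 2 ≤ y ^ 2) (hy2 : y ^ 2 ≤ 3 / 4)
    (hre : 0 ≤ (((1 / 2 + y * I) / (1 / 2 + y * I - 1)) ^ (k + 1) : ℂ).re) :
    0 < (latticeSum k (x + y * I)).re := by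
  rcases le_total 0 x with h | h
  · exact re_latticeSum_pos_of_nonneg hk h hx hy hy1 hy2 hre
  · have := re_latticeSum_pos_of_nonneg hk (x := -x) (by linarith) (by linarith) hy hy1 hy2 hre
    rw [show (((-x : ℝ) : ℂ) + y * I) = -starRingEnd ℂ (x + y * I) by simp; ring,
      latticeSum_neg_conj, conj_re] at this
    exact this

lemma half_add_tan_mul_I {θ : ℝ} (hθ : Real.cos θ ≠ 0) :
    (1 / 2 + ((Real.tan θ / 2 : ℝ) : ℂ) * I) = ((1 / (2 * Real.cos θ) : ℝ) : ℂ) * exp (θ * I) := by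
  have h : Complex.cos θ ≠ 0 := by rw [← ofReal_cos]; exact_mod_cast hθ
  rw [exp_mul_I, Real.tan_eq_sin_div_cos]
  push_cast
  field_simp

lemma neg_half_add_tan_mul_I {θ : ℝ} (hθ : Real.cos θ ≠ 0) :
    (-(1 / 2) + ((Real.tan θ / 2 : ℝ) : ℂ) * I)
      = ((1 / (2 * Real.cos θ) : ℝ) : ℂ) * exp ((Real.pi - θ : ℝ) * I) := by
  have h : Complex.cos θ ≠ 0 := by rw [← ofReal_cos]; exact_mod_cast hθ
  rw [exp_mul_I, ← ofReal_cos, ← ofReal_sin, Real.cos_pi_sub, Real.sin_pi_sub,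
    Real.tan_eq_sin_div_cos]
  push_cast
  field_simp

lemma half_div_sub_one_eq {θ : ℝ} (hθ : Real.cos θ ≠ 0) :
    (1 / 2 + ((Real.tan θ / 2 : ℝ) : ℂ) * I) / (1 / 2 + ((Real.tan θ / 2 : ℝ) : ℂ) * I - 1)
      = -exp ((2 * θ : ℝ) * I) := by
  have h1 : (1 / 2 + ((Real.tan θ / 2 : ℝ) : ℂ) * I - 1)
      = ((1 / (2 * Real.cos θ) : ℝ) : ℂ) * exp ((Real.pi - θ : ℝ) * I) := by
    rw [← neg_half_add_tan_mul_I hθ]; ring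
  have hc : ((1 / (2 * Real.cos θ) : ℝ) : ℂ) ≠ 0 := by
    exact_mod_cast one_div_ne_zero (mul_ne_zero two_ne_zero hθ)
  rw [h1, half_add_tan_mul_I hθ, mul_div_mul_left _ _ hc, ← exp_sub,
    show (θ * I - (Real.pi - θ : ℝ) * I : ℂ) = (2 * θ : ℝ) * I - Real.pi * I by push_cast; ring,
    exp_sub, exp_pi_mul_I, div_neg, div_one]

lemma half_div_sub_one_pow_eq {θ : ℝ} (hθ : Real.cos θ ≠ 0) {K : ℕ} (hK : Odd K) :
    ((1 / 2 + ((Real.tan θ / 2 : ℝ) : ℂ) * I) / (1 / 2 + ((Real.tan θ / 2 : ℝ) : ℂ) * I - 1)) ^ K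
      = -exp ((2 * K * θ : ℝ) * I) := by
  rw [half_div_sub_one_eq hθ, hK.neg_pow, ← exp_nat_mul]
  congr 2
  push_cast
  ring

lemma derivSeries_eq_latticeSum (k : ℕ) {z : ℂ} (hz : z ≠ 0) :
    derivSeries k (exp (2 * Real.pi * I * z))
      = k.factorial / (-2 * Real.pi * I) ^ (k + 1) * (z ^ (k + 1))⁻¹ * latticeSum k z := by
  have h1 : (k.factorial : ℂ) ≠ 0 := by exact_mod_cast k.factorial_ne_zero
  have h2 : (-2 * Real.pi * I : ℂ) ^ (k + 1) ≠ 0 := pow_ne_zero _ (by simp [Real.pi_ne_zero])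
  have h3 : z ^ (k + 1) ≠ 0 := pow_ne_zero _ hz
  rw [latticeSum]
  field_simp

lemma continuousOn_latticeSum {k : ℕ} (hk : 3 ≤ k) :
    ContinuousOn (latticeSum k) {z | 0 < z.im} := by
  unfold latticeSum
  refine (continuousOn_id.pow _).mul (continuousOn_const.mul ?_)
  refine (differentiableOn_derivSeries hk).continuousOn.comp (by fun_prop) ?_
  intro z hz
  rw [mem_ball_zero_iff, norm_exp_two_pi_I_mul, Real.exp_lt_one_iff]
  have : 0 < z.im := hz
  have := Real.pi_pos
  simp only [Left.neg_neg_iff]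
  positivity

lemma two_pi_mul_card_lt {k : ℕ} (hk : 8 ≤ k) (hke : Even k) {θ : ℝ} (h0 : 0 < θ)
    (h1 : θ < Real.pi / 2) (hy1 : 2 ≤ Real.tan θ ^ 2) (hy2 : Real.tan θ ^ 2 ≤ 3)
    (hcos : Real.cos (2 * ((k + 1 : ℕ) : ℝ) * θ) ≤ 0) (S : Finset ℂ)
    (hS : ∀ a ∈ S, ‖a‖ < Real.exp (-(2 * Real.pi * (Real.tan θ / 2))) ∧ derivSeries k a = 0) :
    2 * Real.pi * S.card < ((k + 1 : ℕ) : ℝ) * (Real.pi - 2 * θ) + Real.pi := by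
  have hc : 0 < Real.cos θ := Real.cos_pos_of_mem_Ioo ⟨by linarith, h1⟩
  set y : ℝ := Real.tan θ / 2 with hy
  have hypos : 0 < y := by
    have := Real.tan_pos_of_pos_of_lt_pi_div_two h0 h1
    positivity
  have hre : 0 ≤ (((1 / 2 + y * I) / (1 / 2 + y * I - 1)) ^ (k + 1) : ℂ).re := by
    rw [hy, half_div_sub_one_pow_eq hc.ne' hke.add_one, neg_re, exp_ofReal_mul_I_re]
    linarith
  have hpos : ∀ x ∈ Icc (-(1 / 2) : ℝ) (1 / 2), 0 < (latticeSum k (x + y * I)).re := fun x hx =>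
    re_latticeSum_pos hk hx.1 hx.2 hypos (by rw [hy]; linarith) (by rw [hy]; linarith) hre
  have him : ∀ x : ℝ, 0 < ((x : ℂ) + y * I).im := fun x => by simpa using hypos
  have hz0 : ∀ x : ℝ, ((x : ℂ) + y * I) ≠ 0 := fun x h => by
    have := him x
    rw [h] at this
    simp at this
  set C : ℂ := k.factorial / (-2 * Real.pi * I) ^ (k + 1) with hC
  have hC0 : C ≠ 0 := div_ne_zero (by exact_mod_cast k.factorial_ne_zero)
    (pow_ne_zero _ (by simp [Real.pi_ne_zero]))
  set r : ℝ := Real.exp (-(2 * Real.pi * y)) with hr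
  have hr1 : r < 1 := by
    rw [hr, Real.exp_lt_one_iff]
    have := Real.pi_pos
    simp only [Left.neg_neg_iff]
    positivity
  have hF : AnalyticOnNhd ℂ (derivSeries k) (closedBall 0 r) :=
    ((differentiableOn_derivSeries (by omega)).analyticOnNhd isOpen_ball).mono
      (closedBall_subset_ball hr1)
  have hline : Continuous fun x : ℝ => ((x : ℂ) + y * I) := by fun_prop
  have key := two_pi_mul_card_le (Real.exp_pos _) hF
    (ℓ := fun x => log C - ((k + 1 : ℕ) : ℂ) * log (x + y * I) + log (latticeSum k (x + y * I)))
    (by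
      refine (continuousOn_const.sub (continuousOn_const.mul ?_)).add ?_
      · exact hline.continuousOn.clog fun x _ => Or.inr (him x).ne'
      · exact ((continuousOn_latticeSum (by omega)).comp hline.continuousOn
          fun x _ => him x).clog fun x hx => Or.inl (hpos x hx))
    (by
      intro x hx
      have hq : (r : ℂ) * exp (2 * Real.pi * I * x) = exp (2 * Real.pi * I * (x + y * I)) := by
        rw [hr, ofReal_exp, ← exp_add]
        congr 1
        push_cast
        linear_combination (-(2 * Real.pi * y) : ℂ) * I_sq
      have hL : latticeSum k (x + y * I) ≠ 0 := fun h => by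
        have := hpos x hx
        rw [h] at this
        simp at this
      rw [hq, derivSeries_eq_latticeSum k (hz0 x), exp_add, exp_sub, exp_log hC0, exp_log hL,
        exp_nat_mul, exp_log (hz0 x)]
      ring) S hS
  have ha1 : arg (((1 / 2 : ℝ) : ℂ) + y * I) = θ := by
    have := half_add_tan_mul_I hc.ne'
    rw [show (((1 / 2 : ℝ) : ℂ)) = 1 / 2 by norm_num, this, exp_mul_I]
    exact arg_mul_cos_add_sin_mul_I (by positivity) ⟨by linarith, by linarith⟩
  have ha2 : arg (((-(1 / 2) : ℝ) : ℂ) + y * I) = Real.pi - θ := by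
    have := neg_half_add_tan_mul_I hc.ne'
    rw [show (((-(1 / 2) : ℝ) : ℂ)) = -(1 / 2) by norm_num, this, exp_mul_I]
    exact arg_mul_cos_add_sin_mul_I (by positivity) ⟨by linarith, by linarith⟩
  have hb1 := (abs_lt.1 (abs_arg_lt_pi_div_two_iff.2 (Or.inl (hpos (1 / 2) (by norm_num))))).2
  have hb2 := (abs_lt.1 (abs_arg_lt_pi_div_two_iff.2 (Or.inl (hpos (-(1 / 2)) (by norm_num))))).1
  have him2 : ∀ w : ℂ, (((k + 1 : ℕ) : ℂ) * w).im = ((k + 1 : ℕ) : ℝ) * w.im := fun w => by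
    rw [← ofReal_natCast, im_ofReal_mul]
  simp only [sub_im, add_im, log_im, him2] at key
  rw [ha1, ha2] at key
  linarith

/-- The value of `q = exp (2πiz)` at `z = 1/2 + it`. -/
noncomputable def nomeOnLine (t : ℝ) : ℝ := -Real.exp (-(2 * Real.pi * t))

lemma exp_two_pi_I_half_add (t : ℝ) :
    exp (2 * Real.pi * I * (1 / 2 + t * I)) = (nomeOnLine t : ℂ) := by
  rw [nomeOnLine, show (2 * Real.pi * I * (1 / 2 + t * I) : ℂ)
    = Real.pi * I + ((-(2 * Real.pi * t) : ℝ) : ℂ) by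
      push_cast; linear_combination (2 * Real.pi * t : ℂ) * I_sq, exp_add, exp_pi_mul_I]
  push_cast
  ring

lemma nomeOnLine_injective : Function.Injective nomeOnLine := by
  intro s t h
  have h2 := Real.exp_injective (neg_injective h)
  have := Real.pi_pos
  have h3 : 2 * Real.pi * s = 2 * Real.pi * t := by linarith
  exact mul_left_cancel₀ (by positivity) h3

lemma nomeOnLine_ne_zero (t : ℝ) : nomeOnLine t ≠ 0 := (neg_neg_of_pos (Real.exp_pos _)).ne

lemma deriv_Ek_half_add_eq_zero_iff {k : ℕ} (hk : 3 ≤ k) (hke : Even k) {t : ℝ} (ht : 0 < t) :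
    deriv (Ek k) (1 / 2 + t * I) = 0 ↔ derivSeries k (nomeOnLine t) = 0 := by
  rw [deriv_Ek_eq_zero_iff hk hke (by simpa using ht), exp_two_pi_I_half_add]

lemma norm_nomeOnLine_lt {s t : ℝ} (h : s < t) :
    ‖(nomeOnLine t : ℂ)‖ < Real.exp (-(2 * Real.pi * s)) := by
  rw [norm_real, nomeOnLine, norm_neg, Real.norm_of_nonneg (Real.exp_pos _).le, Real.exp_lt_exp]
  have := Real.pi_pos
  nlinarith

lemma two_pi_mul_card_add_one_lt {k : ℕ} (hk : 8 ≤ k) (hke : Even k) {θ : ℝ} (h0 : 0 < θ)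
    (h1 : θ < Real.pi / 2) (hy1 : 2 ≤ Real.tan θ ^ 2) (hy2 : Real.tan θ ^ 2 ≤ 3)
    (hcos : Real.cos (2 * ((k + 1 : ℕ) : ℝ) * θ) ≤ 0) (T : Finset ℝ)
    (hT : ∀ t ∈ T, Real.tan θ / 2 < t ∧ derivSeries k (nomeOnLine t) = 0) :
    2 * Real.pi * (T.card + 1) < ((k + 1 : ℕ) : ℝ) * (Real.pi - 2 * θ) + Real.pi := by
  have hinj : Function.Injective fun t => (nomeOnLine t : ℂ) :=
    ofReal_injective.comp nomeOnLine_injective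
  have h0mem : (0 : ℂ) ∉ T.image fun t => (nomeOnLine t : ℂ) := by
    intro h
    obtain ⟨t, -, ht⟩ := Finset.mem_image.1 h
    exact nomeOnLine_ne_zero t (by exact_mod_cast ht)
  have := two_pi_mul_card_lt hk hke h0 h1 hy1 hy2 hcos
    (insert 0 (T.image fun t => (nomeOnLine t : ℂ))) (by
      intro a ha
      rcases Finset.mem_insert.1 ha with rfl | ha
      · exact ⟨by simpa using Real.exp_pos _, derivSeries_zero k⟩
      · obtain ⟨t, ht, rfl⟩ := Finset.mem_image.1 ha
        exact ⟨norm_nomeOnLine_lt (hT t ht).1, (hT t ht).2⟩)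
  rw [Finset.card_insert_of_notMem h0mem, Finset.card_image_of_injective _ hinj] at this
  exact_mod_cast this

lemma card_le_of_mod_ne_two {k : ℕ} (hk : 8 ≤ k) (hke : Even k) (h6 : k % 6 ≠ 2) (T : Finset ℝ)
    (hT : ∀ t ∈ T, Real.sqrt 3 / 2 < t ∧ derivSeries k (nomeOnLine t) = 0) :
    T.card ≤ (k - 4) / 6 := by
  have hpi := Real.pi_pos
  have hcos : Real.cos (2 * ((k + 1 : ℕ) : ℝ) * (Real.pi / 3)) ≤ 0 := by
    have h : k % 6 = 0 ∨ k % 6 = 4 := by have := Nat.even_iff.1 hke; omega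
    have h2 : Real.cos (2 * (Real.pi / 3)) = -(1 / 2) := by
      rw [Real.cos_two_mul, Real.cos_pi_div_three]; norm_num
    rcases h with h | h
    · obtain ⟨m, rfl⟩ : ∃ m, k = 6 * m := ⟨k / 6, by omega⟩
      rw [show 2 * ((6 * m + 1 : ℕ) : ℝ) * (Real.pi / 3)
        = 2 * (Real.pi / 3) + (2 * m : ℕ) * (2 * Real.pi) by push_cast; ring,
        Real.cos_add_nat_mul_two_pi, h2]
      norm_num
    · obtain ⟨m, rfl⟩ : ∃ m, k = 6 * m + 4 := ⟨k / 6, by omega⟩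
      rw [show 2 * ((6 * m + 4 + 1 : ℕ) : ℝ) * (Real.pi / 3)
        = (2 * m + 2 : ℕ) * (2 * Real.pi) - 2 * (Real.pi / 3) by push_cast; ring,
        Real.cos_nat_mul_two_pi_sub, h2]
      norm_num
  have := two_pi_mul_card_add_one_lt hk hke (θ := Real.pi / 3) (by positivity) (by linarith)
    (by rw [Real.tan_pi_div_three]; norm_num) (by rw [Real.tan_pi_div_three]; norm_num) hcos T
    (by rw [Real.tan_pi_div_three]; exact hT)
  have h3 : (6 * T.card + 2 : ℝ) < k := by
    push_cast at this
    nlinarith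
  have h4 : 6 * T.card + 2 < k := by exact_mod_cast h3
  have := Nat.even_iff.1 hke
  omega

lemma two_le_tan_sq {ε : ℝ} (h0 : 0 ≤ ε) (h1 : ε ≤ 7 / 80) :
    2 ≤ Real.tan (Real.pi / 3 - ε) ^ 2 := by
  have hpi := Real.pi_gt_three
  have hc : 0 < Real.cos (Real.pi / 3 - ε) :=
    Real.cos_pos_of_mem_Ioo ⟨by linarith, by linarith⟩
  have hs : Real.cos (Real.pi / 3 - ε) ≤ 1 / 2 + Real.sqrt 3 / 2 * ε := by
    rw [Real.cos_sub, Real.cos_pi_div_three, Real.sin_pi_div_three]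
    have := Real.cos_le_one ε
    have h2 := mul_le_mul_of_nonneg_left (Real.sin_le h0)
      (by positivity : (0 : ℝ) ≤ Real.sqrt 3 / 2)
    linarith
  have h3 : Real.cos (Real.pi / 3 - ε) ^ 2 ≤ 1 / 3 := by
    have h4 : Real.sqrt 3 ≤ 1.7321 := by
      rw [Real.sqrt_le_left (by norm_num)]; norm_num
    have h5 : Real.cos (Real.pi / 3 - ε) ≤ 577 / 1000 := by nlinarith [Real.sqrt_nonneg 3]
    nlinarith
  rw [Real.tan_eq_sin_div_cos, div_pow, le_div_iff₀ (by positivity), Real.sin_sq]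
  linarith

lemma card_le_of_mod_eq_two {k : ℕ} (hk : 8 ≤ k) (hke : Even k) (h6 : k % 6 = 2) (T : Finset ℝ)
    (hT : ∀ t ∈ T, Real.sqrt 3 / 2 < t ∧ derivSeries k (nomeOnLine t) = 0) :
    T.card ≤ (k - 4) / 6 := by
  have hpi := Real.pi_pos
  have hpi2 := Real.pi_lt_d2
  have hk' : (8 : ℝ) ≤ k := by exact_mod_cast hk
  set K : ℝ := ((k + 1 : ℕ) : ℝ) with hK
  have hK9 : 9 ≤ K := by rw [hK]; push_cast; linarith
  set ε : ℝ := Real.pi / (4 * K) with hε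
  have hε0 : 0 < ε := by positivity
  have hεK : K * ε = Real.pi / 4 := by rw [hε]; field_simp
  have hε1 : ε ≤ 7 / 80 := by nlinarith
  have htan : Real.tan (Real.pi / 3 - ε) < Real.sqrt 3 := by
    rw [← Real.tan_pi_div_three]
    refine Real.tan_lt_tan_of_lt_of_lt_pi_div_two ?_ ?_ ?_ <;> linarith [Real.pi_gt_three]
  have htan0 : 0 < Real.tan (Real.pi / 3 - ε) :=
    Real.tan_pos_of_pos_of_lt_pi_div_two (by linarith [Real.pi_gt_three]) (by linarith)
  have hcos : Real.cos (2 * K * (Real.pi / 3 - ε)) ≤ 0 := by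
    obtain ⟨m, hm⟩ : ∃ m, k = 6 * m + 2 := ⟨k / 6, by omega⟩
    have h : 2 * K * (Real.pi / 3 - ε) = (2 * m + 1 : ℕ) * (2 * Real.pi) - Real.pi / 2 := by
      have h1 : K = 6 * m + 3 := by rw [hK, hm]; push_cast; ring
      have h2 : 2 * K * (Real.pi / 3 - ε) = 2 * K * (Real.pi / 3) - 2 * (K * ε) := by ring
      rw [h2, hεK, h1]
      push_cast
      ring
    rw [h, Real.cos_nat_mul_two_pi_sub, Real.cos_pi_div_two]
  have hρ : derivSeries k (nomeOnLine (Real.sqrt 3 / 2)) = 0 := by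
    rw [← deriv_Ek_half_add_eq_zero_iff (by omega) hke (by positivity)]
    simpa using deriv_Ek_rho_eq_zero (k := k) (by omega) hke h6
  have hmem : Real.sqrt 3 / 2 ∉ T := fun h => lt_irrefl _ (hT _ h).1
  have := two_pi_mul_card_add_one_lt hk hke (θ := Real.pi / 3 - ε)
    (by linarith [Real.pi_gt_three]) (by linarith)
    (two_le_tan_sq hε0.le hε1)
    (by nlinarith [Real.sq_sqrt (show (0 : ℝ) ≤ 3 by norm_num)]) hcos
    (insert (Real.sqrt 3 / 2) T) (by
      intro t ht
      rcases Finset.mem_insert.1 ht with rfl | ht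
      · exact ⟨by linarith, hρ⟩
      · exact ⟨by linarith [(hT t ht).1], (hT t ht).2⟩)
  rw [Finset.card_insert_of_notMem hmem, ← hK] at this
  have h3 : (12 * T.card + 13 : ℝ) < 2 * k := by
    have h5 : K * (Real.pi - 2 * (Real.pi / 3 - ε)) = K * (Real.pi / 3) + 2 * (K * ε) := by ring
    rw [h5, hεK, hK] at this
    push_cast at this
    nlinarith
  have h4 : 12 * T.card + 13 < 2 * k := by exact_mod_cast h3
  omega

lemma card_zeros_le {k : ℕ} (hk : 8 ≤ k) (hke : Even k) (T : Finset ℝ)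
    (hT : ∀ t ∈ T, Real.sqrt 3 / 2 < t ∧ derivSeries k (nomeOnLine t) = 0) :
    T.card ≤ (k - 4) / 6 := by
  by_cases h6 : k % 6 = 2
  · exact card_le_of_mod_eq_two hk hke h6 T hT
  · exact card_le_of_mod_ne_two hk hke h6 T hT

/-- The real power series `derivSeries k`, evaluated at the nome of `1/2 + it`. -/
noncomputable def lineSeries (k : ℕ) (t : ℝ) : ℝ := ∑' n, derivCoeff k n * nomeOnLine t ^ n

lemma derivSeries_nomeOnLine (k : ℕ) (t : ℝ) :
    derivSeries k (nomeOnLine t) = (lineSeries k t : ℂ) := derivSeries_ofReal k _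

lemma latticeSum_half_add_tan {j : ℕ} {θ : ℝ} (hθ : Real.cos θ ≠ 0) :
    latticeSum (2 * j) (1 / 2 + ((Real.tan θ / 2 : ℝ) : ℂ) * I)
      = ((((1 / (2 * Real.cos θ)) ^ (2 * j + 1) * ((2 * Real.pi) ^ (2 * j + 1) / (2 * j).factorial)
          * (-1) ^ j * lineSeries (2 * j) (Real.tan θ / 2) : ℝ) : ℂ))
        * (-I * exp ((((2 * j + 1 : ℕ) : ℝ) * θ : ℝ) * I)) := by
  have h1 : exp ((((2 * j + 1 : ℕ) : ℝ) * θ : ℝ) * I) = exp (θ * I) ^ (2 * j + 1) := by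
    rw [← exp_nat_mul]
    congr 1
    push_cast
    ring
  have h2 : (-2 * Real.pi * I : ℂ) ^ (2 * j + 1) = (2 * Real.pi) ^ (2 * j + 1) * (-1) ^ j * (-I) := by
    have : (-2 * Real.pi * I : ℂ) = (2 * Real.pi) * (-I) := by ring
    rw [this, mul_pow, pow_succ (-I), pow_mul, neg_sq, I_sq]
    ring
  rw [latticeSum, exp_two_pi_I_half_add, derivSeries_nomeOnLine, half_add_tan_mul_I hθ, h1, h2]
  push_cast
  ring

lemma one_sub_exp_two_mul (φ : ℝ) :
    1 - exp ((2 * φ : ℝ) * I) = ((2 * Real.sin φ : ℝ) : ℂ) * (-I * exp (φ * I)) := by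
  have h : exp ((2 * φ : ℝ) * I) = exp (φ * I) ^ 2 := by
    rw [← exp_nat_mul]
    congr 1
    push_cast
    ring
  rw [h, exp_mul_I]
  push_cast
  linear_combination (2 * Complex.sin φ ^ 2 - Complex.sin φ ^ 2) * I_sq - Complex.sin_sq_add_cos_sq φ

lemma norm_half_add_div_pow_le {t : ℝ} (ht : 0 < t) {K : ℕ} (hK : 2 ≤ K) {w : ℂ} {m : ℝ}
    (hm : 0 < m) (hw : ‖w‖ ^ 2 = t ^ 2 + 1 / 4 + m) :
    ‖((1 / 2 + t * I) / w) ^ K‖ ≤ 2 * (t ^ 2 + 1 / 4) / K * (1 / m) := by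
  have hX : ‖(1 / 2 + t * I : ℂ)‖ ^ 2 = t ^ 2 + 1 / 4 := by
    rw [← normSq_eq_norm_sq, normSq_apply]; simp; ring
  have hK' : (2 : ℝ) ≤ K := by exact_mod_cast hK
  set X : ℝ := t ^ 2 + 1 / 4 with hXd
  have hX0 : 0 < X := by positivity
  have h1 : 1 + m / X ≤ (‖w‖ / ‖(1 / 2 + t * I : ℂ)‖) ^ 2 := by
    rw [div_pow, hX, hw, add_div, div_self hX0.ne']
  have h2 := one_add_mul_le_pow_of_sq (by positivity) (by positivity) h1 hK
  refine (norm_div_pow_le (A := K / 2 * (m / X)) (by positivity) (by linarith)).trans (le_of_eq ?_)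
  field_simp

lemma abs_sub_two_mul_sin_le {j : ℕ} (hj : 4 ≤ j) {θ : ℝ} (h1 : Real.pi / 3 ≤ θ)
    (h2 : θ < Real.pi / 2) (hcos : 1 ≤ ((2 * j + 1 : ℕ) : ℝ) * Real.cos θ ^ 2) :
    |(1 / (2 * Real.cos θ)) ^ (2 * j + 1) * ((2 * Real.pi) ^ (2 * j + 1) / (2 * j).factorial)
          * (-1) ^ j * lineSeries (2 * j) (Real.tan θ / 2)
        - 2 * Real.sin (((2 * j + 1 : ℕ) : ℝ) * θ)| ≤ 5 / 4 := by
  have hpi := Real.pi_pos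
  have hc : 0 < Real.cos θ := Real.cos_pos_of_mem_Ioo ⟨by linarith, h2⟩
  have hc2 : Real.cos θ ≤ 1 / 2 := by
    rw [← Real.cos_pi_div_three]
    exact Real.cos_le_cos_of_nonneg_of_le_pi (by positivity) (by linarith) h1
  set t : ℝ := Real.tan θ / 2 with ht
  have ht0 : 0 < t := by
    have := Real.tan_pos_of_pos_of_lt_pi_div_two (by linarith) h2
    positivity
  have hX : ‖(1 / 2 + t * I : ℂ)‖ ^ 2 = t ^ 2 + 1 / 4 := by
    rw [← normSq_eq_norm_sq, normSq_apply]; simp; ring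
  have hXc : (t ^ 2 + 1 / 4) * (4 * Real.cos θ ^ 2) = 1 := by
    rw [ht, Real.tan_eq_sin_div_cos]
    field_simp
    linarith [Real.sin_sq_add_cos_sq θ]
  set K : ℝ := ((2 * j + 1 : ℕ) : ℝ) with hK
  have hK9 : 9 ≤ K := by
    rw [hK]; exact_mod_cast (by omega : 9 ≤ 2 * j + 1)
  have hXK : t ^ 2 + 1 / 4 ≤ K / 4 := by
    have : 0 < t ^ 2 + 1 / 4 := by positivity
    nlinarith
  have hX1 : 1 ≤ t ^ 2 + 1 / 4 := by
    have : Real.cos θ ^ 2 ≤ 1 / 4 := by nlinarith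
    nlinarith
  have hmain := norm_latticeSum_sub_le (k := 2 * j) (by omega) (z := 1 / 2 + t * I)
    (by simpa using ht0) (by rw [hX]; simp; linarith) (by rw [hX]; exact hXK)
    (β₁ := 2 * (t ^ 2 + 1 / 4) / K) (β₂ := 2 * (t ^ 2 + 1 / 4) / K)
    (fun n => norm_half_add_div_pow_le ht0 (by omega) (by positivity) (by
      rw [← normSq_eq_norm_sq, normSq_apply]; simp; ring))
    (fun n => norm_half_add_div_pow_le ht0 (by omega) (by positivity) (by
      rw [← normSq_eq_norm_sq, normSq_apply]; simp; ring))
  rw [ht, half_div_sub_one_pow_eq hc.ne' (odd_two_mul_add_one j), latticeSum_half_add_tan hc.ne',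
    ← sub_eq_add_neg, mul_assoc 2, one_sub_exp_two_mul, ← sub_mul, ← ofReal_sub, norm_mul,
    norm_mul, norm_neg, norm_I, norm_exp_ofReal_mul_I, mul_one, mul_one, norm_real,
    Real.norm_eq_abs, ← ht] at hmain
  refine hmain.trans ?_
  have : 2 * (t ^ 2 + 1 / 4) / K ≤ 1 / 2 := by
    rw [div_le_iff₀ (by linarith)]; linarith
  linarith

lemma mul_lineSeries_pos_of_sin {j : ℕ} (hj : 4 ≤ j) {θ : ℝ} (h1 : Real.pi / 3 ≤ θ)
    (h2 : θ < Real.pi / 2) (hcos : 1 ≤ ((2 * j + 1 : ℕ) : ℝ) * Real.cos θ ^ 2) {σ : ℝ}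
    (hσ : |σ| ≤ 1) (hs : 4 / 5 ≤ σ * Real.sin (((2 * j + 1 : ℕ) : ℝ) * θ)) :
    0 < σ * (-1) ^ j * lineSeries (2 * j) (Real.tan θ / 2) := by
  have hpi := Real.pi_pos
  have hc : 0 < Real.cos θ := Real.cos_pos_of_mem_Ioo ⟨by linarith, h2⟩
  have h := abs_sub_two_mul_sin_le hj h1 h2 hcos
  have hP : 0 < (1 / (2 * Real.cos θ)) ^ (2 * j + 1)
      * ((2 * Real.pi) ^ (2 * j + 1) / (2 * j).factorial) := by positivity
  generalize (1 / (2 * Real.cos θ)) ^ (2 * j + 1)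
      * ((2 * Real.pi) ^ (2 * j + 1) / (2 * j).factorial) = P at h hP
  generalize lineSeries (2 * j) (Real.tan θ / 2) = g at h ⊢
  generalize Real.sin (((2 * j + 1 : ℕ) : ℝ) * θ) = s at h hs
  have h3 : |σ * (P * (-1) ^ j * g - 2 * s)| ≤ 5 / 4 := by
    rw [abs_mul]
    exact (mul_le_of_le_one_left (abs_nonneg _) hσ).trans h
  have h4 : 0 < P * (σ * (-1) ^ j * g) := by nlinarith [(abs_le.1 h3).1]
  exact pos_of_mul_pos_right h4 hP.le

lemma natCast_pow_mul_le_upper {k n i : ℕ} (hn : 1 ≤ n) {x u : ℝ} (hx : 0 < x)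
    (hu : (1 + 1 / (n : ℝ)) ^ k * x ≤ u) :
    ((n + i : ℕ) : ℝ) ^ k * x ^ (n + i) ≤ (n : ℝ) ^ k * x ^ n * u ^ i := by
  have hn' : (0 : ℝ) < n := by exact_mod_cast hn
  have h1 : ((n + i : ℕ) : ℝ) ≤ n * (1 + 1 / (n : ℝ)) ^ i := by
    have := one_add_mul_le_pow (a := 1 / (n : ℝ)) (by
      have : 0 ≤ 1 / (n : ℝ) := by positivity
      linarith) i
    calc ((n + i : ℕ) : ℝ) = n * (1 + i * (1 / (n : ℝ))) := by push_cast; field_simp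
      _ ≤ _ := mul_le_mul_of_nonneg_left this hn'.le
  calc ((n + i : ℕ) : ℝ) ^ k * x ^ (n + i)
      ≤ (n * (1 + 1 / (n : ℝ)) ^ i) ^ k * x ^ (n + i) := by gcongr
    _ = (n : ℝ) ^ k * x ^ n * ((1 + 1 / (n : ℝ)) ^ k * x) ^ i := by ring
    _ ≤ _ := by gcongr

lemma natCast_pow_mul_le_lower {k n m i : ℕ} (hn : 1 ≤ n) (hmi : m + i = n) {x v : ℝ} (hx : 0 < x)
    (hv : (1 - 1 / (n : ℝ)) ^ k ≤ v * x) :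
    (m : ℝ) ^ k * x ^ m ≤ (n : ℝ) ^ k * x ^ n * v ^ i := by
  have hn' : (0 : ℝ) < n := by exact_mod_cast hn
  have hn1 : 1 / (n : ℝ) ≤ 1 := by
    rw [div_le_one hn']; exact_mod_cast hn
  have h1 : (m : ℝ) ≤ n * (1 - 1 / (n : ℝ)) ^ i := by
    have := one_add_mul_le_pow (a := -(1 / (n : ℝ))) (by linarith) i
    rw [← sub_eq_add_neg] at this
    calc (m : ℝ) = n * (1 + i * -(1 / (n : ℝ))) := by
          rw [← hmi]
          have : ((m + i : ℕ) : ℝ) ≠ 0 := by rw [hmi]; exact hn'.ne'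
          field_simp
          push_cast
          ring
      _ ≤ _ := mul_le_mul_of_nonneg_left this hn'.le
  have h0 : 0 ≤ 1 - 1 / (n : ℝ) := by linarith
  calc (m : ℝ) ^ k * x ^ m
      ≤ (n * (1 - 1 / (n : ℝ)) ^ i) ^ k * x ^ m := by gcongr
    _ = (n : ℝ) ^ k * x ^ m * ((1 - 1 / (n : ℝ)) ^ k) ^ i := by ring
    _ ≤ (n : ℝ) ^ k * x ^ m * (v * x) ^ i := by gcongr
    _ = _ := by rw [← hmi]; ring

lemma sum_pow_succ_le {v : ℝ} (h0 : 0 ≤ v) (h1 : v < 1) (n : ℕ) :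
    ∑ i ∈ Finset.range n, v ^ (i + 1) ≤ v / (1 - v) := by
  have hs := summable_geometric_of_lt_one h0 h1
  have h := hs.sum_le_tsum (Finset.range n) (fun i _ => by positivity)
  rw [tsum_geometric_of_lt_one h0 h1] at h
  simp_rw [pow_succ']
  rw [← Finset.mul_sum, div_eq_mul_inv]
  gcongr

/-- If the `n`-th term of the series dominates its neighbours, it determines the sign of the
alternating sum. -/
lemma neg_one_pow_mul_tsum_pos {k n : ℕ} (hk : 3 ≤ k) (hn : 1 ≤ n) {x : ℝ} (hx : 0 < x)
    (hx1 : x < 1) (hu : (1 + 1 / (n : ℝ)) ^ k * x ≤ 3 / 10)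
    (hv : (1 - 1 / (n : ℝ)) ^ k ≤ 3 / 50 * x) :
    0 < (-1) ^ n * ∑' m, derivCoeff k m * (-x) ^ m := by
  set f : ℕ → ℝ := fun m => derivCoeff k m * (-x) ^ m with hf
  set b : ℝ := (n : ℝ) ^ k * x ^ n with hb
  have hb0 : 0 < b := by
    have : (0 : ℝ) < n := by exact_mod_cast hn
    positivity
  have habs : ∀ m, |f m| = derivCoeff k m * x ^ m := fun m => by
    rw [hf, abs_mul, abs_pow, abs_neg, abs_of_pos hx, abs_of_nonneg (derivCoeff_nonneg k m)]
  have hle : ∀ m, |f m| ≤ 2 * ((m : ℝ) ^ k * x ^ m) := fun m => by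
    rw [habs, ← mul_assoc]
    exact mul_le_mul_of_nonneg_right (derivCoeff_le hk) (by positivity)
  have hsum : Summable fun m => |f m| := by
    simp_rw [habs]
    exact summable_derivCoeff_mul_pow hk hx.le hx1
  have hsum' : Summable f := hsum.of_abs
  have hsplit := hsum'.sum_add_tsum_nat_add (n + 1)
  rw [Finset.sum_range_succ] at hsplit
  have hlow : |∑ m ∈ Finset.range n, f m| ≤ 2 * b * (3 / 47) := by
    refine (Finset.abs_sum_le_sum_abs _ _).trans ?_
    rw [← Finset.sum_range_reflect]
    calc ∑ i ∈ Finset.range n, |f (n - 1 - i)|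
        ≤ ∑ i ∈ Finset.range n, 2 * (b * (3 / 50) ^ (i + 1)) := by
          refine Finset.sum_le_sum fun i hi => (hle _).trans ?_
          have hi' := Finset.mem_range.1 hi
          exact mul_le_mul_of_nonneg_left
            (natCast_pow_mul_le_lower (m := n - 1 - i) (i := i + 1) hn (by omega) hx hv) zero_le_two
      _ = 2 * b * ∑ i ∈ Finset.range n, (3 / 50 : ℝ) ^ (i + 1) := by
          rw [Finset.mul_sum]
          exact Finset.sum_congr rfl fun i _ => by ring
      _ ≤ 2 * b * (3 / 47) := by
          have := sum_pow_succ_le (v := 3 / 50) (by norm_num) (by norm_num) n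
          norm_num at this ⊢
          gcongr
  have hup : |∑' i, f (i + (n + 1))| ≤ 2 * b * (3 / 7) := by
    have hg : HasSum (fun i : ℕ => 2 * b * (3 / 10) * (3 / 10 : ℝ) ^ i) (2 * b * (3 / 7)) := by
      have := (hasSum_geometric_of_lt_one (r := 3 / 10) (by norm_num) (by norm_num)).mul_left
        (2 * b * (3 / 10))
      rwa [show 2 * b * (3 / 10) * (1 - 3 / 10 : ℝ)⁻¹ = 2 * b * (3 / 7) by norm_num; ring] at this
    rw [← Real.norm_eq_abs]
    refine tsum_of_norm_bounded hg fun i => ?_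
    rw [Real.norm_eq_abs]
    refine (hle _).trans ?_
    have := natCast_pow_mul_le_upper (i := i + 1) hn hx hu
    rw [show i + (n + 1) = n + (i + 1) by ring]
    calc _ ≤ 2 * (b * (3 / 10) ^ (i + 1)) := by gcongr
      _ = _ := by ring
  have hmid : b ≤ (-1) ^ n * f n := by
    have : (-1) ^ n * f n = derivCoeff k n * x ^ n := by
      rw [hf]
      have h2 : ((-1 : ℝ) ^ n) * (-1) ^ n = 1 := by rw [← mul_pow]; norm_num
      simp only
      rw [neg_pow x]
      linear_combination derivCoeff k n * x ^ n * h2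
    rw [this]
    exact mul_le_mul_of_nonneg_right (pow_le_derivCoeff (by omega)) (by positivity)
  have hsgn : ∀ y : ℝ, -|y| ≤ (-1) ^ n * y := fun y => by
    have : |(-1) ^ n * y| = |y| := by rw [abs_mul, abs_pow]; simp
    rw [← this]
    exact neg_abs_le _
  rw [← hsplit, mul_add, mul_add]
  linarith [hsgn (∑ m ∈ Finset.range n, f m), hsgn (∑' i, f (i + (n + 1)))]

lemma one_add_le_exp_sub_sq {y : ℝ} (h0 : 0 ≤ y) (h1 : y ≤ 1) :
    1 + y ≤ Real.exp (y - y ^ 2 / 6) := by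
  have h := Real.quadratic_le_exp_of_nonneg (x := y - y ^ 2 / 6) (by nlinarith)
  nlinarith [mul_nonneg (sq_nonneg y) (sub_nonneg.2 h1), sq_nonneg (y ^ 2)]

lemma one_sub_le_exp_neg_sq {y : ℝ} (h0 : 0 ≤ y) (h1 : y ≤ 1) :
    1 - y ≤ Real.exp (-y - y ^ 2 / 2) := by
  rcases h1.eq_or_lt with rfl | h1
  · simpa using (Real.exp_pos _).le
  have h := sum_le_hasSum (Finset.range 2) (fun i _ => by positivity)
    (Real.hasSum_pow_div_log_of_abs_lt_one (x := y) (by rw [abs_of_nonneg h0]; exact h1))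
  rw [← Real.log_le_iff_le_exp (by linarith)]
  norm_num [Finset.sum_range_succ] at h
  linarith

lemma exp_neg_four_thirds_le : Real.exp (-(4 / 3)) ≤ 3 / 10 := by
  have h := Real.exp_one_gt_d9
  rw [Real.exp_neg, inv_le_comm₀ (Real.exp_pos _) (by norm_num)]
  refine (pow_le_pow_iff_left₀ (by norm_num) (Real.exp_pos _).le (n := 3) (by norm_num)).1 ?_
  rw [← Real.exp_nat_mul, show ((3 : ℕ) : ℝ) * (4 / 3) = (4 : ℕ) * 1 by norm_num, Real.exp_nat_mul]
  calc _ ≤ (2.718 : ℝ) ^ 4 := by norm_num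
    _ ≤ _ := by gcongr; linarith

lemma exp_neg_three_le : Real.exp (-3) ≤ 3 / 50 := by
  have h := Real.exp_one_gt_d9
  rw [Real.exp_neg, inv_le_comm₀ (Real.exp_pos _) (by norm_num)]
  rw [show (3 : ℝ) = (3 : ℕ) * 1 by norm_num, Real.exp_nat_mul]
  calc _ ≤ (2.718 : ℝ) ^ 3 := by norm_num
    _ ≤ _ := by gcongr; linarith

lemma neg_one_pow_mul_tsum_exp_pos {k n : ℕ} (hk : 3 ≤ k) (hn : 1 ≤ n) (hkn : 8 * n ^ 2 ≤ k) :
    0 < (-1) ^ n * ∑' m, derivCoeff k m * (-Real.exp (-((k + 1) / n))) ^ m := by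
  have hn' : (1 : ℝ) ≤ n := by exact_mod_cast hn
  have hkn' : 8 * (n : ℝ) ^ 2 ≤ k := by exact_mod_cast hkn
  set y : ℝ := 1 / n with hy
  have hy0 : 0 < y := by positivity
  have hy1 : y ≤ 1 := by rw [hy, div_le_one (by linarith)]; exact hn'
  have hky : 8 ≤ k * y ^ 2 := by
    rw [hy, div_pow, one_pow, mul_one_div, le_div_iff₀ (by positivity)]; exact hkn'
  have hdiv : ((k : ℝ) + 1) / n = (k + 1) * y := by rw [hy]; ring
  rw [hdiv]
  refine neg_one_pow_mul_tsum_pos hk hn (Real.exp_pos _) ?_ ?_ ?_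
  · rw [Real.exp_lt_one_iff]
    simp only [Left.neg_neg_iff]
    positivity
  · rw [← hy]
    calc (1 + y) ^ k * Real.exp (-((k + 1) * y))
        ≤ Real.exp (y - y ^ 2 / 6) ^ k * Real.exp (-((k + 1) * y)) := by
          gcongr
          exact one_add_le_exp_sub_sq hy0.le hy1
      _ = Real.exp (-(k * y ^ 2 / 6) - y) := by
          rw [← Real.exp_nat_mul, ← Real.exp_add]
          ring_nf
      _ ≤ Real.exp (-(4 / 3)) := by
          rw [Real.exp_le_exp]; linarith
      _ ≤ _ := exp_neg_four_thirds_le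
  · rw [← hy]
    calc (1 - y) ^ k ≤ Real.exp (-y - y ^ 2 / 2) ^ k := by
          have : 0 ≤ 1 - y := by linarith
          gcongr
          exact one_sub_le_exp_neg_sq hy0.le hy1
      _ = Real.exp (-(k * y ^ 2 / 2) + y) * Real.exp (-((k + 1) * y)) := by
          rw [← Real.exp_nat_mul, ← Real.exp_add]
          ring_nf
      _ ≤ Real.exp (-3) * Real.exp (-((k + 1) * y)) := by
          gcongr
          linarith
      _ ≤ _ := by
          gcongr
          exact exp_neg_three_le

lemma continuousOn_lineSeries {k : ℕ} (hk : 3 ≤ k) : ContinuousOn (lineSeries k) (Ioi 0) := by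
  have h : ContinuousOn (fun t : ℝ => derivSeries k (nomeOnLine t)) (Ioi 0) := by
    refine (differentiableOn_derivSeries hk).continuousOn.comp ?_ ?_
    · unfold nomeOnLine
      fun_prop
    · intro t ht
      simpa using norm_nomeOnLine_lt (mem_Ioi.1 ht)
  refine (continuous_re.comp_continuousOn h).congr fun t _ => ?_
  simp [derivSeries_nomeOnLine]

/-- Points on the half-line at which the sign of `lineSeries` alternates. -/
noncomputable def samplePoint (k n : ℕ) : ℝ :=
  if 8 * n ^ 2 ≤ k then (k + 1) / (2 * Real.pi * n)
  else if 6 * n ≤ k then Real.tan (Real.pi / 2 - Real.pi * n / (k + 1)) / 2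
  else Real.sqrt 3 / 2

lemma pi_mul_div_lt {k n : ℕ} (h : 6 * n ≤ k) : Real.pi * n / (k + 1) < Real.pi / 6 := by
  have hpi := Real.pi_pos
  have h' : 6 * (n : ℝ) ≤ k := by exact_mod_cast h
  rw [div_lt_iff₀ (by positivity)]
  nlinarith

lemma sqrt_three_half_lt_samplePoint {k n : ℕ} (hn : 1 ≤ n) (h : 6 * n ≤ k) :
    Real.sqrt 3 / 2 < samplePoint k n := by
  have hpi := Real.pi_pos
  have hn' : (1 : ℝ) ≤ n := by exact_mod_cast hn
  have h' : 6 * (n : ℝ) ≤ k := by exact_mod_cast h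
  have h3 : Real.sqrt 3 ≤ 1.7321 := by
    rw [Real.sqrt_le_left (by norm_num)]; norm_num
  rw [samplePoint]
  split_ifs
  · rw [lt_div_iff₀ (by positivity)]
    have : Real.pi * Real.sqrt 3 < 6 := by nlinarith [Real.pi_lt_d2, Real.sqrt_nonneg 3]
    nlinarith
  · have := pi_mul_div_lt h
    have h0 : 0 < Real.pi * n / (k + 1) := by positivity
    gcongr
    rw [← Real.tan_pi_div_three]
    refine Real.tan_lt_tan_of_lt_of_lt_pi_div_two ?_ ?_ ?_ <;> linarith

lemma sqrt_three_half_le_samplePoint {k n : ℕ} (hn : 1 ≤ n) :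
    Real.sqrt 3 / 2 ≤ samplePoint k n := by
  by_cases h6 : 6 * n ≤ k
  · exact (sqrt_three_half_lt_samplePoint hn h6).le
  · rw [samplePoint, if_neg (by nlinarith), if_neg h6]

lemma samplePoint_succ_lt {k n : ℕ} (hn : 1 ≤ n) (h : 6 * n + 4 ≤ k) :
    samplePoint k (n + 1) < samplePoint k n := by
  have hpi := Real.pi_pos
  have hn' : (1 : ℝ) ≤ n := by exact_mod_cast hn
  by_cases h6 : 6 * (n + 1) ≤ k
  swap
  · rw [samplePoint, if_neg (by nlinarith), if_neg h6]
    exact sqrt_three_half_lt_samplePoint hn (by omega)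
  have h2 := pi_mul_div_lt h6
  have h0 : 0 < Real.pi * (n + 1 : ℕ) / (k + 1) := by positivity
  by_cases h8 : 8 * n ^ 2 ≤ k
  · have hle : samplePoint k (n + 1) ≤ (k + 1) / (2 * Real.pi * (n + 1 : ℕ)) := by
      rw [samplePoint]
      split_ifs
      · exact le_rfl
      · rw [Real.tan_pi_div_two_sub]
        have h3 := Real.lt_tan h0 (by linarith)
        have h4 := inv_anti₀ h0 h3.le
        calc _ ≤ (Real.pi * (n + 1 : ℕ) / (k + 1))⁻¹ / 2 := by gcongr
          _ = _ := by
            push_cast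
            field_simp
    refine hle.trans_lt ?_
    rw [samplePoint, if_pos h8]
    push_cast
    gcongr
    linarith
  · rw [samplePoint, if_neg (by nlinarith), if_pos h6, samplePoint, if_neg h8, if_pos (by omega)]
    have h3 : Real.pi * n / (k + 1) < Real.pi * (n + 1 : ℕ) / (k + 1) := by
      push_cast
      gcongr
      linarith
    have h1 : 0 < Real.pi * n / (k + 1) := by positivity
    gcongr
    refine Real.tan_lt_tan_of_lt_of_lt_pi_div_two ?_ ?_ ?_ <;> linarith

lemma eight_mul_sq_le_sin_sq {x : ℝ} (h0 : 0 < x) (h1 : x ≤ Real.pi / 6) :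
    8 * x ^ 2 ≤ Real.pi ^ 2 * Real.sin x ^ 2 := by
  have hx : x ≤ 21 / 40 := by linarith [Real.pi_lt_d2]
  have h2 := Real.sin_gt_sub_cube h0
  have h3 : 93 / 100 * x ≤ Real.sin x := by
    have : x * x ^ 2 ≤ x * (42 / 100) := by
      gcongr
      nlinarith
    linarith
  have h4 : (93 / 100 * x) ^ 2 ≤ Real.sin x ^ 2 := pow_le_pow_left₀ (by positivity) h3 2
  have h5 : 9.8596 ≤ Real.pi ^ 2 := by nlinarith [Real.pi_gt_d2]
  nlinarith [sq_nonneg x, sq_nonneg (Real.sin x)]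

lemma neg_one_pow_mul_lineSeries_pos_of_sqrt_three {m : ℕ} (hm : 1 ≤ m) :
    0 < (-1) ^ (m + 1) * lineSeries (6 * m + 4) (Real.sqrt 3 / 2) := by
  have hpi := Real.pi_pos
  have h3 : 1.6 ≤ Real.sqrt 3 := Real.le_sqrt_of_sq_le (by norm_num)
  have hsin : Real.sin (((2 * (3 * m + 2) + 1 : ℕ) : ℝ) * (Real.pi / 3)) = -(Real.sqrt 3 / 2) := by
    rw [show ((2 * (3 * m + 2) + 1 : ℕ) : ℝ) * (Real.pi / 3)
      = (m + 1 : ℕ) * (2 * Real.pi) - Real.pi / 3 by push_cast; ring,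
      Real.sin_nat_mul_two_pi_sub, Real.sin_pi_div_three]
  have := mul_lineSeries_pos_of_sin (j := 3 * m + 2) (by omega) (θ := Real.pi / 3) le_rfl
    (by linarith) (by
      rw [Real.cos_pi_div_three]
      push_cast
      have : (1 : ℝ) ≤ m := by exact_mod_cast hm
      linarith) (σ := -1) (by norm_num) (by rw [hsin]; linarith)
  rw [Real.tan_pi_div_three, show 2 * (3 * m + 2) = 6 * m + 4 by ring] at this
  rwa [show (-1 : ℝ) ^ (m + 1) = -1 * (-1) ^ (3 * m + 2) by
    rw [pow_succ, pow_add, pow_mul]; norm_num]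

lemma lineSeries_sqrt_three_pos_of_six {m : ℕ} (hm : 2 ≤ m) :
    0 < (-1) ^ m * lineSeries (6 * m) (Real.sqrt 3 / 2) := by
  have hpi := Real.pi_pos
  have h3 : 1.6 ≤ Real.sqrt 3 := Real.le_sqrt_of_sq_le (by norm_num)
  have hsin : Real.sin (((2 * (3 * m) + 1 : ℕ) : ℝ) * (Real.pi / 3)) = Real.sqrt 3 / 2 := by
    rw [show ((2 * (3 * m) + 1 : ℕ) : ℝ) * (Real.pi / 3)
      = Real.pi / 3 + m * (2 * Real.pi) by push_cast; ring,
      Real.sin_add_nat_mul_two_pi, Real.sin_pi_div_three]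
  have := mul_lineSeries_pos_of_sin (j := 3 * m) (by omega) (θ := Real.pi / 3) le_rfl
    (by linarith) (by
      rw [Real.cos_pi_div_three]
      push_cast
      have : (2 : ℝ) ≤ m := by exact_mod_cast hm
      linarith) (σ := 1) (by norm_num) (by rw [hsin]; linarith)
  rw [Real.tan_pi_div_three, show 2 * (3 * m) = 6 * m by ring, one_mul, pow_mul] at this
  norm_num at this
  exact this

lemma neg_one_pow_mul_lineSeries_samplePoint_pos {k n : ℕ} (hk : 8 ≤ k) (hke : Even k)
    (hn : 1 ≤ n) (h : 6 * n ≤ k + 2) : 0 < (-1) ^ n * lineSeries k (samplePoint k n) := by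
  have hpi := Real.pi_pos
  have hn' : (1 : ℝ) ≤ n := by exact_mod_cast hn
  rw [samplePoint]
  split_ifs with h8 h6
  · have := neg_one_pow_mul_tsum_exp_pos (by omega) hn h8
    rwa [lineSeries, nomeOnLine, show 2 * Real.pi * ((k + 1) / (2 * Real.pi * n))
      = ((k : ℝ) + 1) / n by field_simp]
  · obtain ⟨j, rfl⟩ := hke.two_dvd
    have hlt := pi_mul_div_lt h6
    have h0 : 0 < Real.pi * n / ((2 * j : ℕ) + 1) := by positivity
    have hsin : Real.sin (((2 * j + 1 : ℕ) : ℝ) * (Real.pi / 2 - Real.pi * n / ((2 * j : ℕ) + 1)))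
        = (-1) ^ n * (-1) ^ j := by
      have : ((2 * j + 1 : ℕ) : ℝ) * (Real.pi / 2 - Real.pi * n / ((2 * j : ℕ) + 1))
          = Real.pi / 2 + j * Real.pi - n * Real.pi := by
        push_cast
        field_simp
        ring
      rw [this, Real.sin_sub_nat_mul_pi, Real.sin_add_nat_mul_pi, Real.sin_pi_div_two, mul_one]
    have hone : ∀ i : ℕ, ((-1 : ℝ) ^ i) * (-1) ^ i = 1 := fun i => by rw [← mul_pow]; norm_num
    have := mul_lineSeries_pos_of_sin (j := j) (by omega)
      (θ := Real.pi / 2 - Real.pi * n / ((2 * j : ℕ) + 1)) (by linarith) (by linarith) (by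
        rw [Real.cos_pi_div_two_sub]
        have hs := eight_mul_sq_le_sin_sq h0 hlt.le
        have h8' : ((2 * j : ℕ) : ℝ) + 1 ≤ 8 * (n : ℝ) ^ 2 := by
          exact_mod_cast (by omega : 2 * j + 1 ≤ 8 * n ^ 2)
        rw [Nat.cast_add_one (2 * j)]
        generalize Real.sin (Real.pi * n / ((2 * j : ℕ) + 1)) ^ 2 = S at hs ⊢
        have hK : (0 : ℝ) < (2 * j : ℕ) + 1 := by positivity
        generalize ((2 * j : ℕ) : ℝ) + 1 = K at *
        rw [div_pow, mul_pow, ← mul_div_assoc, div_le_iff₀ (by positivity)] at hs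
        have h9 : 8 * (n : ℝ) ^ 2 ≤ S * K ^ 2 := by
          refine le_of_mul_le_mul_left (a := Real.pi ^ 2) ?_ (by positivity)
          linarith
        have h10 : K * 1 ≤ K * (K * S) := by linarith
        exact le_of_mul_le_mul_left h10 hK)
      (σ := (-1) ^ n * (-1) ^ j) (by simp [abs_mul, abs_pow]) (by
        rw [hsin, mul_mul_mul_comm, hone, hone]; norm_num)
    rwa [mul_assoc ((-1 : ℝ) ^ n), hone, mul_one] at this
  · obtain ⟨m, rfl⟩ : ∃ m, k = 6 * m + 4 := ⟨k / 6, by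
      have := Nat.even_iff.1 hke
      omega⟩
    obtain rfl : n = m + 1 := by omega
    exact neg_one_pow_mul_lineSeries_pos_of_sqrt_three (by omega)

lemma exists_zero_between {k n : ℕ} (hk : 8 ≤ k) (hke : Even k) (hn : 1 ≤ n)
    (h : 6 * n + 4 ≤ k) : ∃ t, samplePoint k (n + 1) < t ∧ t < samplePoint k n ∧
      lineSeries k t = 0 := by
  have hs1 := neg_one_pow_mul_lineSeries_samplePoint_pos hk hke hn (by omega)
  have hs2 := neg_one_pow_mul_lineSeries_samplePoint_pos hk hke (n := n + 1) (by omega) (by omega)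
  have hlt := samplePoint_succ_lt hn h
  have hge := sqrt_three_half_le_samplePoint (k := k) (n := n + 1) (by omega)
  have hpos : 0 < Real.sqrt 3 / 2 := by positivity
  have hcont : ContinuousOn (fun t => (-1) ^ n * lineSeries k t)
      (Icc (samplePoint k (n + 1)) (samplePoint k n)) :=
    continuousOn_const.mul ((continuousOn_lineSeries (by omega)).mono fun t ht => by
      have := ht.1
      exact mem_Ioi.2 (by linarith))
  have hmem : (0 : ℝ) ∈ Ioo ((-1) ^ n * lineSeries k (samplePoint k (n + 1)))
      ((-1) ^ n * lineSeries k (samplePoint k n)) := by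
    refine ⟨?_, hs1⟩
    rw [pow_succ] at hs2
    linarith
  obtain ⟨t, ht, ht0⟩ := intermediate_value_Ioo hlt.le hcont hmem
  refine ⟨t, ht.1, ht.2, ?_⟩
  simpa using ht0

lemma exists_finset_zeros {k : ℕ} (hk : 8 ≤ k) (hke : Even k) :
    ∃ T : Finset ℝ, T.card = (k - 4) / 6 ∧
      ∀ t ∈ T, Real.sqrt 3 / 2 < t ∧ lineSeries k t = 0 := by
  have hex : ∀ i : Fin ((k - 4) / 6), ∃ t, samplePoint k (i + 2) < t ∧ t < samplePoint k (i + 1) ∧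
      lineSeries k t = 0 := fun i =>
    exists_zero_between hk hke (n := i + 1) (by omega) (by omega)
  choose t ht1 ht2 ht0 using hex
  have hanti : ∀ a b : ℕ, a ≤ b → 6 * b + 4 ≤ k →
      samplePoint k (b + 1) ≤ samplePoint k (a + 1) := by
    intro a b hab
    induction b, hab using Nat.le_induction with
    | base => exact fun _ => le_rfl
    | succ b hb ih =>
      intro h
      exact (samplePoint_succ_lt (by omega) (by omega)).le.trans (ih (by omega))
  have hinj : Function.Injective t := by
    have hlt : ∀ i j, i < j → t j < t i := fun i j hij => by
      have := hanti (i + 1) j (by omega) (by omega)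
      exact ((ht2 j).trans_le this).trans (ht1 i)
    intro i j hij
    by_contra hne
    rcases lt_or_gt_of_ne hne with h | h
    · exact (hlt _ _ h).ne' hij
    · exact (hlt _ _ h).ne hij
  refine ⟨Finset.univ.image t, by rw [Finset.card_image_of_injective _ hinj]; simp, ?_⟩
  intro s hs
  obtain ⟨i, -, rfl⟩ := Finset.mem_image.1 hs
  refine ⟨(sqrt_three_half_le_samplePoint (by omega)).trans_lt (ht1 i), ht0 i⟩

lemma lineSeries_ne_zero_of_le_six {k : ℕ} (hk : 3 ≤ k) (hk6 : k ≤ 6) {t : ℝ}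
    (ht : Real.sqrt 3 / 2 ≤ t) : lineSeries k t ≠ 0 := by
  have h3 : 1.732 ≤ Real.sqrt 3 := Real.le_sqrt_of_sq_le (by norm_num)
  have hpi := Real.pi_gt_d2
  have hx : Real.exp (-(2 * Real.pi * t)) ≤ 3 / 640 := by
    have h1 : Real.exp (-(2 * Real.pi * t)) ≤ Real.exp (-(27 / 5)) := by
      rw [Real.exp_le_exp]
      nlinarith
    refine h1.trans ?_
    have h := Real.exp_one_gt_d9
    rw [Real.exp_neg, inv_le_comm₀ (Real.exp_pos _) (by norm_num)]
    refine (pow_le_pow_iff_left₀ (by norm_num) (Real.exp_pos _).le (n := 5) (by norm_num)).1 ?_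
    rw [← Real.exp_nat_mul, show ((5 : ℕ) : ℝ) * (27 / 5) = (27 : ℕ) * 1 by norm_num,
      Real.exp_nat_mul]
    calc _ ≤ (2.718 : ℝ) ^ 27 := by norm_num
      _ ≤ _ := by gcongr; linarith
  have := neg_one_pow_mul_tsum_pos hk le_rfl (Real.exp_pos (-(2 * Real.pi * t))) (by linarith)
    (by
      have h2 : (1 + 1 / ((1 : ℕ) : ℝ)) ^ k ≤ 64 := by
        norm_num
        calc (2 : ℝ) ^ k ≤ 2 ^ 6 := pow_le_pow_right₀ (by norm_num) hk6
          _ = 64 := by norm_num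
      nlinarith [Real.exp_pos (-(2 * Real.pi * t))])
    (by
      rw [Nat.cast_one, div_one, sub_self, zero_pow (by omega)]
      positivity)
  intro h0
  rw [lineSeries, nomeOnLine] at h0
  rw [h0] at this
  simp at this

lemma lineSeries_sqrt_three_ne_zero {k : ℕ} (hke : Even k) (hk4 : 4 ≤ k) (h6 : k % 6 ≠ 2) :
    lineSeries k (Real.sqrt 3 / 2) ≠ 0 := by
  rcases le_or_gt k 6 with hk | hk
  · exact lineSeries_ne_zero_of_le_six (by omega) hk le_rfl
  have he := Nat.even_iff.1 hke
  have : k % 6 = 0 ∨ k % 6 = 4 := by omega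
  rcases this with h | h
  · obtain ⟨m, rfl⟩ : ∃ m, k = 6 * m := ⟨k / 6, by omega⟩
    have := lineSeries_sqrt_three_pos_of_six (m := m) (by omega)
    exact (right_ne_zero_of_mul this.ne')
  · obtain ⟨m, rfl⟩ : ∃ m, k = 6 * m + 4 := ⟨k / 6, by omega⟩
    have := neg_one_pow_mul_lineSeries_pos_of_sqrt_three (m := m) (by omega)
    exact (right_ne_zero_of_mul this.ne')

lemma finite_and_ncard_eq {α : Type*} {s : Set α} {M : ℕ}
    (hle : ∀ T : Finset α, (∀ t ∈ T, t ∈ s) → T.card ≤ M)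
    (hex : ∃ T : Finset α, T.card = M ∧ ∀ t ∈ T, t ∈ s) : s.Finite ∧ s.ncard = M := by
  classical
  obtain ⟨T, hTM, hTs⟩ := hex
  have hsT : s = T := by
    refine Subset.antisymm (fun a ha => ?_) hTs
    by_contra haT
    have h := hle (insert a T) fun t ht => by
      rcases Finset.mem_insert.1 ht with rfl | ht
      exacts [ha, hTs t ht]
    rw [Finset.card_insert_of_notMem haT] at h
    omega
  rw [hsT]
  exact ⟨T.finite_toSet, by rw [Set.ncard_coe_finset, hTM]⟩

theorem stmt1 (k : ℕ) (hke : Even k) (hk4 : 4 ≤ k) :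
    (deriv (Ek k) (1 / 2 + (Real.sqrt 3 / 2) * Complex.I) = 0 ↔ k % 6 = 2) ∧
    {t : ℝ | Real.sqrt 3 / 2 < t ∧ deriv (Ek k) (1 / 2 + t * Complex.I) = 0}.Finite ∧
    {t : ℝ | Real.sqrt 3 / 2 < t ∧ deriv (Ek k) (1 / 2 + t * Complex.I) = 0}.ncard
      = (k - 4) / 6 := by
  have hpos : 0 < Real.sqrt 3 / 2 := by positivity
  have hiff : ∀ {t : ℝ}, 0 < t → (deriv (Ek k) (1 / 2 + t * I) = 0 ↔ lineSeries k t = 0) := by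
    intro t ht
    rw [deriv_Ek_half_add_eq_zero_iff (by omega) hke ht, derivSeries_nomeOnLine, ofReal_eq_zero]
  refine ⟨⟨fun h => ?_, deriv_Ek_rho_eq_zero (by omega) hke⟩, ?_⟩
  · by_contra h6
    refine lineSeries_sqrt_three_ne_zero hke hk4 h6 ((hiff hpos).1 ?_)
    simpa using h
  have hmem : ∀ t, t ∈ {t : ℝ | Real.sqrt 3 / 2 < t ∧ deriv (Ek k) (1 / 2 + t * I) = 0} ↔
      Real.sqrt 3 / 2 < t ∧ lineSeries k t = 0 := fun t =>
    and_congr_right fun ht => hiff (hpos.trans ht)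
  refine finite_and_ncard_eq (fun T hT => ?_) ?_
  · simp only [hmem] at hT
    rcases le_or_gt k 6 with hk | hk
    · rw [Finset.eq_empty_of_forall_notMem fun t ht =>
        lineSeries_ne_zero_of_le_six (by omega) hk (hT t ht).1.le (hT t ht).2]
      simp
    · have := Nat.even_iff.1 hke
      exact card_zeros_le (by omega) hke T fun t ht =>
        ⟨(hT t ht).1, by rw [derivSeries_nomeOnLine, (hT t ht).2, ofReal_zero]⟩
  · simp only [hmem]
    rcases le_or_gt k 6 with hk | hk
    · exact ⟨∅, by simp; omega, by simp⟩
    · have := Nat.even_iff.1 hke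
      exact exists_finset_zeros (by omega) hke
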